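/- There is a positive constant c such that, for every odd integer k ≥ 5, every two-coloring of the edges of the complete graph on 2k−1 vertices with colors red and blue contains at least (ck)^k monochromatic cycles of length k, where a monochromatic cycle of length k is a cycle on k vertices all of whose edges receive the same color, and cycles are counted as subgraphs (each subgraph isomorphic to C_k counted once). -/

import Mathlib

noncomputable section

/-- The number of cycles with `k` vertices in `G`, counted as subgraphs: each cycle subgraph
on `k ≥ 3` vertices corresponds to exactly `2 * k` injective cyclic sequences of its vertices. -/
def cycleCount {V : Type*} (G : SimpleGraph V) (k : ℕ) : ℕ :=
  Nat.card {p : ZMod k → V // Function.Injective p ∧ ∀ i, G.Adj (p i) (p (i + 1))} / (2 * k)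

/-- A list of distinct vertices that are consecutively adjacent, the last one being adjacent to
the first one. -/
def IsCyc {V : Type*} (G : SimpleGraph V) (l : List V) : Prop :=
  l.Nodup ∧ l.IsChain G.Adj ∧ ∀ a ∈ l.getLast?, ∀ b ∈ l.head?, G.Adj a b

/-- `G` contains a cycle with `m` vertices, given as a list. -/
def HasCyc {V : Type*} (G : SimpleGraph V) (m : ℕ) : Prop :=
  ∃ l : List V, l.length = m ∧ IsCyc G l

section Basics

variable {V : Type*} {G : SimpleGraph V}

/-- The successive vertices of a cycle as an injective map from the cyclic group. -/
lemma IsCyc.zmod {l : List V} {m : ℕ} [NeZero m] (hl : l.length = m) (h : IsCyc G l) :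
    ∃ p : ZMod m → V, (∀ i : ZMod m, l[i.val]? = some (p i)) ∧ Function.Injective p ∧
      ∀ i, G.Adj (p i) (p (i + 1)) := by
  have hlt : ∀ i : ZMod m, i.val < l.length := fun i => hl ▸ i.val_lt
  refine ⟨fun i => l[i.val]'(hlt i), fun i => ?_, ?_, ?_⟩
  · simp [hlt i]
  · intro i j hij
    have := (h.1.getElem_inj_iff (hi := hlt i) (hj := hlt j)).1 hij
    exact ZMod.val_injective m this
  · intro i
    have hi := hlt i
    by_cases hc : i.val + 1 < m
    · have hv : (i + 1).val = i.val + 1 := by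
        have h1 : (i + 1 : ZMod m) = ((i.val + 1 : ℕ) : ZMod m) := by
          push_cast; rw [ZMod.natCast_zmod_val]
        rw [h1, ZMod.val_natCast, Nat.mod_eq_of_lt hc]
      have := List.isChain_iff_getElem.1 h.2.1 i.val (by omega)
      simpa [hv] using this
    · have hv : i.val = m - 1 := by have := i.val_lt; omega
      have hm := NeZero.pos m
      have hv' : (i + 1).val = 0 := by
        have h1 : (i + 1 : ZMod m) = ((i.val + 1 : ℕ) : ZMod m) := by
          push_cast; rw [ZMod.natCast_zmod_val]
        rw [h1, ZMod.val_natCast, hv, Nat.sub_add_cancel hm, Nat.mod_self]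
      apply h.2.2
      · simp [List.getLast?_eq_getElem?, hl, hv]
      · simp only [hv']
        rw [List.head?_eq_getElem?]
        simp

lemma card_le_cyclic_maps [Finite V] {m : ℕ} [NeZero m] (F : Finset (List V))
    (hF : ∀ l ∈ F, l.length = m ∧ IsCyc G l) :
    F.card ≤ Nat.card {p : ZMod m → V // Function.Injective p ∧ ∀ i, G.Adj (p i) (p (i + 1))} := by
  choose f hf using fun l (hl : l ∈ F) => (hF l hl).2.zmod (hF l hl).1
  rw [← Nat.card_eq_finsetCard]
  refine Nat.card_le_card_of_injective (fun l : F => ⟨f l.1 l.2, (hf l.1 l.2).2⟩) ?_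
  rintro ⟨l, hl⟩ ⟨l', hl'⟩ h
  simp only [Subtype.mk.injEq] at h ⊢
  have e1 := (hf l hl).1
  have e2 := (hf l' hl').1
  rw [h] at e1
  apply List.ext_getElem?
  intro i
  by_cases hi : i < m
  · have a1 := e1 (i : ZMod m)
    have a2 := e2 (i : ZMod m)
    rw [ZMod.val_natCast, Nat.mod_eq_of_lt hi] at a1 a2
    rw [a1, a2]
  · rw [List.getElem?_eq_none (by have := (hF l hl).1; omega),
      List.getElem?_eq_none (by have := (hF l' hl').1; omega)]

/-- The rotations and reflections of a cycle show that cycles are not lost in the division by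
`2 * m`. -/
lemma HasCyc.one_le_cycleCount [Finite V] {m : ℕ} (hm : 3 ≤ m) (h : HasCyc G m) :
    1 ≤ cycleCount G m := by
  obtain ⟨l, hl, hc⟩ := h
  have : NeZero m := ⟨by omega⟩
  have : Fact (1 < m) := ⟨by omega⟩
  obtain ⟨p, -, hinj, hadj⟩ := hc.zmod hl
  unfold cycleCount
  rw [Nat.le_div_iff_mul_le (by omega), one_mul]
  have hcard : Nat.card (Bool × ZMod m) = 2 * m := by simp
  rw [← hcard]
  have h2 : (2 : ZMod m) ≠ 0 := by
    intro h
    have := (ZMod.natCast_eq_zero_iff 2 m).1 (by exact_mod_cast h)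
    have := Nat.le_of_dvd (by norm_num) this
    omega
  refine Nat.card_le_card_of_injective (fun x : Bool × ZMod m =>
    ⟨fun i => p ((if x.1 then i else -i) + x.2), ?_, ?_⟩) ?_
  · intro i j hij
    have := hinj hij
    split_ifs at this <;> simpa using this
  · intro i
    dsimp only
    split_ifs with hb
    · have := hadj (i + x.2)
      rwa [add_right_comm] at this
    · have := hadj (-(i + 1) + x.2)
      have e : -(i + 1) + x.2 + 1 = -i + x.2 := by ring
      rw [e] at this
      exact this.symm
  · rintro ⟨b, x⟩ ⟨b', x'⟩ hxx
    simp only [Subtype.mk.injEq] at hxx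
    have h0 := hinj (congrFun hxx 0)
    have h1 := hinj (congrFun hxx 1)
    have hx : x = x' := by simpa using h0
    subst hx
    have h1' := add_right_cancel h1
    cases b <;> cases b' <;> simp at h1' ⊢
    · exact h2 (by rw [← one_add_one_eq_two]; nth_rewrite 1 [← h1']; ring)
    · exact h2 (by rw [← one_add_one_eq_two]; nth_rewrite 1 [h1']; ring)

end Basics

section ErdosGallai

open Finset

variable {V : Type*} {G : SimpleGraph V}

lemma isChain_adj_reverse {l : List V} : l.reverse.IsChain G.Adj ↔ l.IsChain G.Adj := by
  rw [List.isChain_reverse]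
  simp only [G.adj_comm]

/-- A longest path inside a finset. -/
lemma exists_longest_path [DecidableEq V] (U : Finset V) (hU : U.Nonempty) :
    ∃ l : List V, l ≠ [] ∧ (l.Nodup ∧ (∀ v ∈ l, v ∈ U) ∧ l.IsChain G.Adj) ∧
      ∀ l' : List V, (l'.Nodup ∧ (∀ v ∈ l', v ∈ U) ∧ l'.IsChain G.Adj) →
        l'.length ≤ l.length := by
  classical
  obtain ⟨u, hu⟩ := hU
  let P : ℕ → Prop := fun n => ∃ l : List V, l.length = n ∧
    (l.Nodup ∧ (∀ v ∈ l, v ∈ U) ∧ l.IsChain G.Adj)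
  have hb : ∀ l : List V, l.Nodup → (∀ v ∈ l, v ∈ U) → l.length ≤ #U := by
    intro l hl hlU
    rw [← List.toFinset_card_of_nodup hl]
    exact card_le_card (fun v hv => hlU v (by simpa using hv))
  have h1 : P 1 := ⟨[u], rfl, by simp, by simpa using hu, by simp⟩
  have h1U : 1 ≤ #U := card_pos.2 ⟨u, hu⟩
  have hspec := Nat.findGreatest_spec (P := P) h1U h1
  have hge := Nat.le_findGreatest (P := P) h1U h1
  obtain ⟨l, hl, hl'⟩ := hspec
  refine ⟨l, ?_, hl', ?_⟩
  · rintro rfl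
    simp at hl
    omega
  · intro l' h'
    rw [hl]
    exact Nat.le_findGreatest (hb l' h'.1 h'.2.1) ⟨l', rfl, h'⟩

variable [DecidableEq V] [DecidableRel G.Adj]

/-- If all cycles have at most `c` vertices, then some proper subset of `U` meets few edges. -/
lemma exists_low_degree_set {c : ℕ} (hc : 2 ≤ c) (h : ∀ l, IsCyc G l → l.length ≤ c)
    (U : Finset V) (hU : U.Nonempty) (hE : ∃ x ∈ U, ∃ y ∈ U, G.Adj x y) :
    ∃ S ⊆ U, S.Nonempty ∧ S ≠ U ∧
      ∀ x ∈ S, #{y ∈ U | G.Adj x y} + #{y ∈ U \ S | G.Adj x y} ≤ c := by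
  classical
  obtain ⟨l, hl0, ⟨hnd, hlU, hch⟩, hmax⟩ := exists_longest_path (G := G) U hU
  have hl2 : 2 ≤ l.length := by
    obtain ⟨x, hx, y, hy, hxy⟩ := hE
    exact hmax [x, y] ⟨by simpa using hxy.ne, by simp [hx, hy], by simpa using hxy⟩
  obtain ⟨B, a, A, rfl, hBc, hB0, hA⟩ : ∃ B a A, l = B ++ a :: A ∧ B.length + 1 ≤ c ∧ B ≠ [] ∧
      (A ≠ [] → B.length + 1 = c) := by
    have hr : min (c - 1) (l.length - 1) < l.length := by omega
    refine ⟨l.take (min (c - 1) (l.length - 1)), l[min (c - 1) (l.length - 1)],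
      l.drop (min (c - 1) (l.length - 1) + 1), ?_, ?_, ?_, ?_⟩
    · simp
    · simp; omega
    · intro h0
      have := congrArg List.length h0
      simp at this
      omega
    · intro h0
      have : 0 < (l.drop (min (c - 1) (l.length - 1) + 1)).length :=
        List.length_pos_iff.2 h0
      simp at this ⊢
      omega
  set S : Finset V := U.filter fun x => ∃ B1, (x :: B1).Perm B ∧
    (x :: B1 ++ a :: A).IsChain G.Adj with hS
  have hSB : ∀ x ∈ S, x ∈ B := by
    intro x hx
    obtain ⟨-, B1, hp, -⟩ := mem_filter.1 hx
    exact hp.subset (by simp)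
  have haB : a ∉ B := by
    intro haB
    exact (List.nodup_append.1 hnd).2.2 a haB a (by simp) rfl
  have hBnd : B.Nodup := (List.nodup_append.1 hnd).1
  -- the neighbours of an endpoint lie in `B` or equal `a`, and the endpoint has degree at most `#S`
  have key : ∀ x ∈ S, (∀ y ∈ U, G.Adj x y → y ∈ B ∨ y = a) ∧ #{y ∈ U | G.Adj x y} ≤ #S := by
    intro x hx
    obtain ⟨hxU, B1, hp, hch1⟩ := mem_filter.1 hx
    have hperm : (x :: B1 ++ a :: A).Perm (B ++ a :: A) := hp.append_right _
    have hnd1 := hperm.nodup_iff.2 hnd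
    have hU1 : ∀ v ∈ x :: B1 ++ a :: A, v ∈ U := fun v hv => hlU v (hperm.subset hv)
    have hnb : ∀ y ∈ U, G.Adj x y → y ∈ B1 ++ [a] := by
      intro y hy hxy
      by_contra hcon
      by_cases hyA : y ∈ A
      · obtain ⟨A1, A2, rfl⟩ := List.append_of_mem hyA
        have hcyc : IsCyc G (x :: B1 ++ a :: A1 ++ [y]) := by
          have e : x :: B1 ++ a :: (A1 ++ y :: A2) = (x :: B1 ++ a :: A1 ++ [y]) ++ A2 := by simp
          rw [e] at hnd1 hch1
          refine ⟨(List.nodup_append.1 hnd1).1, hch1.left_of_append, ?_⟩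
          intro u hu v hv
          rw [List.getLast?_append_of_ne_nil _ (by simp)] at hu
          simp at hu hv
          subst hu hv
          exact hxy.symm
        have h1 := h _ hcyc
        have h2 := hA (by simp)
        have h3 := hp.length_eq
        simp at h1 h3
        omega
      · have hyn : y ∉ x :: B1 ++ a :: A := by
          simp at hcon ⊢
          refine ⟨hxy.ne', hcon.1, hcon.2, hyA⟩
        have := hmax (y :: (x :: B1 ++ a :: A)) ⟨List.nodup_cons.2 ⟨hyn, hnd1⟩, ?_, ?_⟩
        · have h3 := hperm.length_eq
          rw [List.length_cons, h3] at this
          omega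
        · intro v hv
          rcases List.mem_cons.1 hv with rfl | hv
          · exact hy
          · exact hU1 v hv
        · rw [List.cons_append, List.isChain_cons_cons]
          exact ⟨hxy.symm, hch1⟩
    refine ⟨?_, ?_⟩
    · intro y hy hxy
      have := hnb y hy hxy
      rcases List.mem_append.1 this with h1 | h1
      · exact Or.inl (hp.subset (by simp [h1]))
      · exact Or.inr (by simpa using h1)
    · set l0 := x :: (B1 ++ [a]) with hl0
      have hnd0 : l0.Nodup := by
        have e : x :: B1 ++ a :: A = l0 ++ A := by simp [hl0]
        rw [e] at hnd1
        exact (List.nodup_append.1 hnd1).1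
      refine card_le_card_of_forall_subsingleton
        (fun y z => l0[l0.idxOf z + 1]? = some y) ?_ ?_
      · intro y hy
        obtain ⟨hyU, hxy⟩ := mem_filter.1 hy
        obtain ⟨s, t, hst⟩ := List.append_of_mem (hnb y hyU hxy)
        obtain ⟨q, z, hqz⟩ : ∃ q z, x :: s = q ++ [z] := by
          rcases List.eq_nil_or_concat (x :: s) with h0 | ⟨q, z, h0⟩
          · simp at h0
          · exact ⟨q, z, by simpa using h0⟩
        obtain ⟨T, hT⟩ : ∃ T, y :: t = T ++ [a] := by
          rcases List.eq_nil_or_concat (y :: t) with h0 | ⟨T, a', h0⟩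
          · simp at h0
          · rw [List.concat_eq_append] at h0
            rw [h0, ← List.append_assoc] at hst
            have := List.append_inj_right' hst rfl
            simp at this
            exact ⟨T, by rw [h0, this]⟩
        have hB1 : x :: B1 = q ++ [z] ++ T := by
          rw [← hqz]
          rw [hT, ← List.append_assoc] at hst
          have := List.append_inj_left' hst rfl
          simp [this]
        have hl0e : l0 = q ++ z :: y :: t := by
          rw [hl0, hst]
          rw [← List.cons_append, hqz]
          simp
        refine ⟨z, ?_, ?_⟩
        · rw [hS, mem_filter]
          refine ⟨hU1 z ?_, q.reverse ++ T, ?_, ?_⟩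
          · rw [hB1]; simp
          · refine List.Perm.trans ?_ hp
            rw [hB1]
            have : z :: (q.reverse ++ T) = (q ++ [z]).reverse ++ T := by simp
            rw [this]
            exact (List.reverse_perm _).append_right _
          · have e1 : z :: (q.reverse ++ T) ++ a :: A = (q ++ [z]).reverse ++ (y :: t ++ A) := by
              rw [hT]; simp
            have e2 : x :: B1 ++ a :: A = (q ++ [z]) ++ (y :: t ++ A) := by
              rw [hT, hB1]; simp
            rw [e2, List.isChain_append] at hch1
            rw [e1, List.isChain_append]
            refine ⟨isChain_adj_reverse.2 hch1.1, hch1.2.1, ?_⟩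
            intro u hu v hv
            rw [← hqz] at hu
            simp at hu hv
            subst hu hv
            exact hxy
        · have hz : z ∉ q := by
            intro hz
            rw [hl0e] at hnd0
            exact (List.nodup_append.1 hnd0).2.2 z hz z (by simp) rfl
          rw [hl0e, List.idxOf_append_of_notMem hz]
          simp
      · intro z _ y hy y' hy'
        have h1 := hy.2
        have h2 := hy'.2
        rw [h1] at h2
        exact Option.some.inj h2
  refine ⟨S, filter_subset _ _, ?_, ?_, ?_⟩
  · obtain ⟨x, B1, rfl⟩ := List.exists_cons_of_ne_nil hB0
    exact ⟨x, mem_filter.2 ⟨hlU x (by simp), B1, List.Perm.refl _, hch⟩⟩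
  · intro hSU
    exact haB (hSB a (hSU ▸ hlU a (by simp)))
  · intro x hx
    have h1 := (key x hx).2
    have h2 : #{y ∈ U \ S | G.Adj x y} ≤ c - #S := by
      have hsub : {y ∈ U \ S | G.Adj x y} ⊆ (insert a B.toFinset) \ S := by
        intro y hy
        simp only [mem_filter, mem_sdiff] at hy
        have := (key x hx).1 y hy.1.1 hy.2
        simp [hy.1.2]
        tauto
      have hSs : S ⊆ insert a B.toFinset := fun y hy => by simp [hSB y hy]
      refine (card_le_card hsub).trans ?_
      rw [card_sdiff_of_subset hSs, card_insert_of_notMem (by simpa using haB),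
        List.toFinset_card_of_nodup hBnd]
      omega
    have h3 : #S ≤ c := by
      have hSs : S ⊆ B.toFinset := fun y hy => by simp [hSB y hy]
      have := card_le_card hSs
      rw [List.toFinset_card_of_nodup hBnd] at this
      omega
    omega

/-- The **Erdős–Gallai theorem** on long cycles. -/
theorem sum_degree_le_of_cycles_le {c : ℕ} (hc : 2 ≤ c) (h : ∀ l, IsCyc G l → l.length ≤ c)
    (U : Finset V) (hU : U.Nonempty) :
    ∑ x ∈ U, #{y ∈ U | G.Adj x y} ≤ c * (#U - 1) := by
  induction hn : #U using Nat.strong_induction_on generalizing U with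
  | _ n ih =>
  subst hn
  by_cases hE : ∃ x ∈ U, ∃ y ∈ U, G.Adj x y
  swap
  · push Not at hE
    rw [sum_eq_zero]
    · simp
    · intro x hx
      rw [card_eq_zero, filter_eq_empty_iff]
      exact fun y hy => hE x hx y hy
  obtain ⟨S, hSU, hS0, hSne, hS⟩ := exists_low_degree_set hc h U hU hE
  have hlt : #(U \ S) < #U := by
    rw [card_sdiff_of_subset hSU]
    have := card_pos.2 hS0
    have := card_le_card hSU
    omega
  have hne : (U \ S).Nonempty := by
    rw [sdiff_nonempty]
    exact fun hh => hSne (hSU.antisymm hh)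
  have hI := ih _ hlt (U \ S) hne rfl
  have e1 : ∀ x, #{y ∈ U | G.Adj x y} = #{y ∈ U \ S | G.Adj x y} + #{y ∈ S | G.Adj x y} := by
    intro x
    rw [← card_union_of_disjoint, ← filter_union, sdiff_union_of_subset hSU]
    exact disjoint_filter_filter sdiff_disjoint
  have e2 : ∑ x ∈ U \ S, #{y ∈ S | G.Adj x y} = ∑ x ∈ S, #{y ∈ U \ S | G.Adj x y} := by
    have := sum_card_bipartiteAbove_eq_sum_card_bipartiteBelow (s := U \ S) (t := S) G.Adj
    unfold bipartiteAbove bipartiteBelow at this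
    rw [this]
    refine sum_congr rfl fun x _ => ?_
    congr 1
    ext y
    simp [G.adj_comm]
  have e3 : ∑ x ∈ S, (#{y ∈ U | G.Adj x y} + #{y ∈ U \ S | G.Adj x y}) ≤ #S * c := by
    rw [← smul_eq_mul]
    exact sum_le_card_nsmul _ _ _ hS
  rw [← sum_sdiff hSU]
  simp_rw [sum_add_distrib] at e3
  have e4 : ∑ x ∈ U \ S, #{y ∈ U | G.Adj x y} =
      ∑ x ∈ U \ S, #{y ∈ U \ S | G.Adj x y} + ∑ x ∈ U \ S, #{y ∈ S | G.Adj x y} := by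
    rw [← sum_add_distrib]
    exact sum_congr rfl fun x _ => e1 x
  rw [e4, e2]
  have h5 : #U = #(U \ S) + #S := by rw [card_sdiff_of_subset hSU]; have := card_le_card hSU; omega
  have h6 := card_pos.2 hne
  have h7 : c * (#U - 1) = c * (#(U \ S) - 1) + #S * c := by
    rw [h5, show #(U \ S) + #S - 1 = (#(U \ S) - 1) + #S by omega]
    ring
  omega

end ErdosGallai

section Paths

open Finset

variable {V : Type*} {G : SimpleGraph V}

/-- There is a path in `G` on `n` vertices, all of them in `S`, from `a` to `b`. -/
def PathIn (G : SimpleGraph V) (S : Set V) (n : ℕ) (a b : V) : Prop :=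
  ∃ l : List V, l.length = n ∧ l.Nodup ∧ l.IsChain G.Adj ∧ (∀ v ∈ l, v ∈ S) ∧
    l.head? = some a ∧ l.getLast? = some b

lemma PathIn.single {S : Set V} {a : V} (ha : a ∈ S) : PathIn G S 1 a a :=
  ⟨[a], by simp [ha]⟩

lemma PathIn.mono {S T : Set V} {n : ℕ} {a b : V} (h : PathIn G S n a b) (hST : S ⊆ T) :
    PathIn G T n a b := by
  obtain ⟨l, h1, h2, h3, h4, h5⟩ := h
  exact ⟨l, h1, h2, h3, fun v hv => hST (h4 v hv), h5⟩

lemma PathIn.append {S T : Set V} {n m : ℕ} {a b c d : V} (h : PathIn G S n a b)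
    (h' : PathIn G T m c d) (hST : Disjoint S T) (hbc : G.Adj b c) :
    PathIn G (S ∪ T) (n + m) a d := by
  obtain ⟨l, h1, h2, h3, h4, h5, h6⟩ := h
  obtain ⟨l', h1', h2', h3', h4', h5', h6'⟩ := h'
  refine ⟨l ++ l', by simp [h1, h1'], ?_, ?_, ?_, ?_, ?_⟩
  · refine List.nodup_append.2 ⟨h2, h2', ?_⟩
    rintro x hx y hy rfl
    exact Set.disjoint_left.1 hST (h4 x hx) (h4' x hy)
  · refine List.isChain_append.2 ⟨h3, h3', ?_⟩
    rw [h6, h5']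
    simpa using hbc
  · intro v hv
    rcases List.mem_append.1 hv with hv | hv
    · exact Or.inl (h4 v hv)
    · exact Or.inr (h4' v hv)
  · simp [h5]
  · simp [h6']

lemma PathIn.hasCyc {S : Set V} {n : ℕ} {a b : V} (h : PathIn G S n a b) (hab : G.Adj b a) :
    HasCyc G n := by
  obtain ⟨l, h1, h2, h3, h4, h5, h6⟩ := h
  refine ⟨l, h1, h2, h3, ?_⟩
  rw [h6, h5]
  simpa using hab

/-- Paths alternating between the two sides of a complete bipartite graph. -/
lemma pathIn_bipartite_even [DecidableEq V] (p : ℕ) : ∀ (X Y : Finset V), Disjoint X Y →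
    (∀ x ∈ X, ∀ y ∈ Y, G.Adj x y) → p + 1 ≤ #X → p + 1 ≤ #Y →
    ∀ x ∈ X, ∀ y ∈ Y, PathIn G (X ∪ Y) (2 * (p + 1)) x y := by
  induction p with
  | zero =>
    intro X Y hXY h _ _ x hx y hy
    have hne : x ≠ y := fun e => disjoint_left.1 hXY hx (e ▸ hy)
    exact ⟨[x, y], by simp [hne, h x hx y hy, hx, hy]⟩
  | succ p ih =>
    intro X Y hXY h hX hY x hx y hy
    obtain ⟨y', hy'⟩ : (Y.erase y).Nonempty := by
      rw [← card_pos, card_erase_of_mem hy]; omega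
    obtain ⟨x', hx'⟩ : (X.erase x).Nonempty := by
      rw [← card_pos, card_erase_of_mem hx]; omega
    have hyY := mem_of_mem_erase hy'
    have hxX := mem_of_mem_erase hx'
    have h1 : PathIn G ({x} : Set V) 1 x x := PathIn.single rfl
    have h2 : PathIn G ({y'} : Set V) 1 y' y' := PathIn.single rfl
    have h3 := ih (X.erase x) (Y.erase y')
      (hXY.mono (erase_subset _ _) (erase_subset _ _))
      (fun a ha b hb => h a (mem_of_mem_erase ha) b (mem_of_mem_erase hb))
      (by rw [card_erase_of_mem hx]; omega) (by rw [card_erase_of_mem hyY]; omega) x' hx' y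
      (mem_erase.2 ⟨(ne_of_mem_erase hy').symm, hy⟩)
    have hne : x ≠ y' := fun e => disjoint_left.1 hXY hx (e ▸ hyY)
    have h4 := (h1.append h2 (by simpa using hne) (h x hx y' hyY)).append h3 (by
      rw [Set.disjoint_left]
      simp only [Set.mem_union, Set.mem_singleton_iff, mem_coe, mem_erase]
      rintro a (rfl | rfl)
      · intro hh
        rcases hh with hh | hh
        · exact hh.1 rfl
        · exact disjoint_left.1 hXY hx hh.2
      · intro hh
        rcases hh with hh | hh
        · exact disjoint_left.1 hXY hh.2 hyY
        · exact hh.1 rfl) (h x' hxX y' hyY).symm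
    have e : 1 + 1 + 2 * (p + 1) = 2 * (p + 1 + 1) := by ring
    rw [e] at h4
    refine h4.mono ?_
    intro a
    simp only [Set.mem_union, Set.mem_singleton_iff, mem_coe, mem_erase]
    rintro ((rfl | rfl) | hh | hh)
    · exact Or.inl hx
    · exact Or.inr hyY
    · exact Or.inl hh.2
    · exact Or.inr hh.2

lemma pathIn_bipartite_odd [DecidableEq V] (p : ℕ) (X Y : Finset V) (hXY : Disjoint X Y)
    (h : ∀ x ∈ X, ∀ y ∈ Y, G.Adj x y) (hX : p + 2 ≤ #X) (hY : p + 1 ≤ #Y)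
    {x x' : V} (hx : x ∈ X) (hx' : x' ∈ X) (hne : x ≠ x') :
    PathIn G (X ∪ Y) (2 * p + 3) x x' := by
  obtain ⟨y, hy⟩ : Y.Nonempty := by rw [← card_pos]; omega
  have h3 := pathIn_bipartite_even (G := G) p (X.erase x') Y
      (hXY.mono (erase_subset _ _) le_rfl)
      (fun a ha b hb => h a (mem_of_mem_erase ha) b hb)
      (by rw [card_erase_of_mem hx']; omega) hY x (mem_erase.2 ⟨hne, hx⟩) y hy
  have h1 : PathIn G ({x'} : Set V) 1 x' x' := PathIn.single rfl
  have h4 := h3.append h1 (by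
      rw [Set.disjoint_singleton_right]
      simp only [Set.mem_union, mem_coe, mem_erase]
      rintro (hh | hh)
      · exact hh.1 rfl
      · exact disjoint_left.1 hXY hx' hh) (h x' hx' y hy).symm
  refine PathIn.mono (show PathIn G _ (2 * p + 3) x x' from h4) ?_
  intro a
  simp only [Set.mem_union, Set.mem_singleton_iff, mem_coe, mem_erase]
  rintro ((hh | hh) | rfl)
  · exact Or.inl hh.2
  · exact Or.inr hh
  · exact Or.inl hx'

lemma pathIn_clique [DecidableEq V] (n : ℕ) (X : Finset V)
    (h : ∀ x ∈ X, ∀ y ∈ X, x ≠ y → G.Adj x y) (hX : n + 2 ≤ #X)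
    {x x' : V} (hx : x ∈ X) (hx' : x' ∈ X) (hne : x ≠ x') :
    PathIn G X (n + 2) x x' := by
  obtain ⟨T, hT, hTc⟩ := exists_subset_card_eq (s := (X.erase x).erase x') (n := n) (by
    rw [card_erase_of_mem (mem_erase.2 ⟨hne.symm, hx'⟩), card_erase_of_mem hx]; omega)
  have hnd : (x :: (T.toList ++ [x'])).Nodup := by
    have h1 : x ∉ T := fun hh => by have := hT hh; simp at this
    have h2 : x' ∉ T := fun hh => by have := hT hh; simp at this
    rw [List.nodup_cons, List.nodup_append]
    refine ⟨by simp [h1, hne], nodup_toList _, by simp, ?_⟩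
    intro a ha b hb
    simp at ha hb
    rintro rfl
    subst hb
    exact h2 ha
  have hmem : ∀ v ∈ x :: (T.toList ++ [x']), v ∈ X := by
    intro v hv
    simp at hv
    rcases hv with rfl | hv | rfl
    · exact hx
    · exact mem_of_mem_erase (mem_of_mem_erase (hT hv))
    · exact hx'
  refine ⟨x :: (T.toList ++ [x']), by simp [hTc], hnd, ?_, hmem, by simp, ?_⟩
  · refine List.Pairwise.isChain ?_
    exact (List.Nodup.pairwise_of_forall_ne hnd fun a ha b hb hab =>
      h a (hmem a ha) b (hmem b hb) hab)
  · rw [← List.cons_append, List.getLast?_concat]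

end Paths

section CyclicSequences

variable {V : Type*} {G : SimpleGraph V}

/-- `p` winds around a cycle with `m` vertices. -/
structure CycSeq (G : SimpleGraph V) (m : ℕ) (p : ℤ → V) : Prop where
  adj : ∀ i, G.Adj (p i) (p (i + 1))
  eq_iff : ∀ a b, p a = p b ↔ (m : ℤ) ∣ a - b

lemma HasCyc.exists_cycSeq {m : ℕ} (hm : 1 ≤ m) (h : HasCyc G m) : ∃ p, CycSeq G m p := by
  obtain ⟨l, hl, hc⟩ := h
  have : NeZero m := ⟨by omega⟩
  obtain ⟨p, -, hp, hadj⟩ := hc.zmod hl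
  refine ⟨fun i => p (i : ZMod m), fun i => ?_, fun a b => ?_⟩
  · have := hadj (i : ZMod m)
    push_cast
    exact this
  · rw [hp.eq_iff, eq_comm, ZMod.intCast_eq_intCast_iff_dvd_sub]

lemma hasCyc_of_fun {m : ℕ} (hm : 1 ≤ m) (q : ℕ → V)
    (hinj : ∀ i < m, ∀ j < m, q i = q j → i = j)
    (hadj : ∀ i, i + 1 < m → G.Adj (q i) (q (i + 1))) (hclose : G.Adj (q (m - 1)) (q 0)) :
    HasCyc G m := by
  refine ⟨(List.range m).map q, by simp, ?_, ?_, ?_⟩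
  · refine List.Nodup.map_on ?_ List.nodup_range
    intro x hx y hy
    exact hinj x (List.mem_range.1 hx) y (List.mem_range.1 hy)
  · rw [List.isChain_iff_getElem]
    intro i hi
    simp only [List.length_map, List.length_range] at hi
    simpa using hadj i hi
  · have e : List.range m = List.range (m - 1) ++ [m - 1] := by
      conv_lhs => rw [show m = (m - 1) + 1 by omega]
      exact List.range_succ
    have e2 : List.range m = 0 :: (List.range (m - 1)).map Nat.succ := by
      conv_lhs => rw [show m = (m - 1) + 1 by omega]
      exact List.range_succ_eq_map
    intro a ha b hb
    rw [e] at ha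
    rw [e2] at hb
    simp at ha hb
    subst ha hb
    exact hclose

namespace CycSeq

variable {m : ℕ} {p : ℤ → V}

lemma neg (h : CycSeq G m p) : CycSeq G m (fun i => p (-i)) := by
  refine ⟨fun i => ?_, fun a b => ?_⟩
  · have := (h.adj (-(i + 1))).symm
    rwa [show -(i + 1) + 1 = -i by ring] at this
  · rw [h.eq_iff, show -a - -b = -(a - b) by ring, dvd_neg]

lemma inj (h : CycSeq G m p) {a b : ℤ} (hab : p a = p b) (h1 : a - b < m) (h2 : b - a < m) :
    a = b := by
  have := Int.eq_zero_of_abs_lt_dvd ((h.eq_iff a b).1 hab) (by rw [abs_lt]; omega)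
  omega

lemma ne (h : CycSeq G m p) {a b : ℤ} (hab : a ≠ b) (h1 : a - b < m) (h2 : b - a < m) :
    p a ≠ p b := fun hh => hab (h.inj hh h1 h2)

lemma closes (h : CycSeq G m p) {a b : ℤ} (hab : (m : ℤ) = a - b + 1) : G.Adj (p a) (p b) := by
  have := h.adj a
  rwa [(h.eq_iff (a + 1) b).2 (by rw [hab]; exact ⟨1, by ring⟩)] at this

lemma hasCyc_of_skip_chord (h : CycSeq G m p) (hm : 4 ≤ m) {x : ℤ}
    (hx : G.Adj (p x) (p (x + 2))) : HasCyc G (m - 1) := by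
  refine hasCyc_of_fun (by omega) (fun i => p (x + if i = 0 then 0 else (i + 1 : ℕ))) ?_ ?_ ?_
  · intro i hi j hj hij
    have := h.inj hij (by split_ifs <;> omega) (by split_ifs <;> omega)
    split_ifs at this <;> omega
  · intro i hi
    rcases i with _ | i
    · simpa using hx
    · have := h.adj (x + (i + 1 + 1 : ℕ))
      simp only [Nat.add_eq_zero_iff, one_ne_zero, and_false, if_false]
      convert this using 2
      push_cast; ring
  · have : m - 1 - 1 ≠ 0 := by omega
    simp only [this, if_false, if_true]
    refine h.closes ?_
    omega

lemma hasCyc_of_parallel_chords (h : CycSeq G m p) {x : ℤ} {y : ℕ} (hy : 2 ≤ y)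
    (hym : y + 2 < m) (h1 : G.Adj (p x) (p (x + y))) (h2 : G.Adj (p (x + 1)) (p (x + y + 2))) :
    HasCyc G (m - 1) := by
  refine hasCyc_of_fun (by omega) (fun i => p (x + if i = 0 then 0 else if i ≤ y then
    (y + 1 - i : ℤ) else (i + 1 : ℤ))) ?_ ?_ ?_
  · intro i hi j hj hij
    have := h.inj hij (by split_ifs <;> omega) (by split_ifs <;> omega)
    split_ifs at this <;> omega
  · intro i hi
    rcases i with _ | i
    · have : 0 + 1 ≤ y := by omega
      simpa [this] using h1
    · rcases lt_trichotomy (i + 1) y with hlt | heq | hgt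
      · have e1 : i + 1 ≤ y := by omega
        have e2 : i + 1 + 1 ≤ y := by omega
        simp only [Nat.add_eq_zero_iff, one_ne_zero, and_false, if_false, e1, e2, if_true]
        have := (h.adj (x + (y + 1 - (i + 1 + 1 : ℕ)))).symm
        convert this using 2
        push_cast; ring
      · have e1 : i + 1 ≤ y := by omega
        have e2 : ¬ i + 1 + 1 ≤ y := by omega
        simp only [Nat.add_eq_zero_iff, one_ne_zero, and_false, if_false, e1, e2, if_true]
        subst heq
        convert h2 using 2
        · push_cast; ring
        · push_cast; ring
      · have e1 : ¬ i + 1 ≤ y := by omega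
        have e2 : ¬ i + 1 + 1 ≤ y := by omega
        simp only [Nat.add_eq_zero_iff, one_ne_zero, and_false, if_false, e1, e2]
        have := h.adj (x + ((i + 1 : ℕ) + 1))
        convert this using 2
        push_cast; ring
  · have e : m - 1 - 1 ≠ 0 := by omega
    have e1 : ¬ m - 1 - 1 ≤ y := by omega
    simp only [e, e1, if_false, if_true]
    refine h.closes ?_
    omega

/-- An odd monochromatic cycle can be shortened by one vertex. -/
lemma hasCyc_pred_of_odd (h : CycSeq G m p) (hm : Odd m) (hm7 : 7 ≤ m) :
    HasCyc G (m - 1) ∨ HasCyc Gᶜ (m - 1) := by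
  by_contra! hno
  obtain ⟨hno, hno'⟩ := hno
  have h2 : ∀ x, Gᶜ.Adj (p x) (p (x + 2)) := fun x =>
    (SimpleGraph.compl_adj _ _ _).2 ⟨h.ne (by omega) (by omega) (by omega),
      fun hh => hno (h.hasCyc_of_skip_chord (by omega) hh)⟩
  have hq : CycSeq Gᶜ m (fun i => p (2 * i)) := by
    refine ⟨fun i => ?_, fun a b => ?_⟩
    · have := h2 (2 * i)
      rwa [show 2 * i + 2 = 2 * (i + 1) by ring] at this
    · rw [h.eq_iff, ← mul_sub]
      refine ⟨fun hd => ?_, fun hd => hd.mul_left _⟩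
      refine IsCoprime.dvd_of_dvd_mul_left ?_ hd
      have : IsCoprime ((m : ℕ) : ℤ) ((2 : ℕ) : ℤ) :=
        Nat.isCoprime_iff_coprime.2 (Nat.coprime_two_right.2 hm)
      exact_mod_cast this
  have h4 : ∀ x : ℤ, G.Adj (p (2 * x)) (p (2 * x + 4)) := by
    intro x
    by_contra hcon
    refine hno' (hq.hasCyc_of_skip_chord (by omega) (x := x)
      ((SimpleGraph.compl_adj _ _ _).2 ⟨hq.ne (by omega) (by omega) (by omega), ?_⟩))
    rwa [show 2 * (x + 2) = 2 * x + 4 by ring]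
  have h4' : ∀ x : ℤ, G.Adj (p x) (p (x + 4)) := by
    intro x
    obtain ⟨s, hs⟩ := hm
    rcases Int.even_or_odd' x with ⟨c, rfl | rfl⟩
    · exact h4 c
    · have := h4 (c + s + 1)
      rwa [(h.eq_iff (2 * (c + s + 1)) (2 * c + 1)).2 ⟨1, by rw [hs]; push_cast; ring⟩,
        (h.eq_iff (2 * (c + s + 1) + 4) (2 * c + 1 + 4)).2 ⟨1, by rw [hs]; push_cast; ring⟩]
        at this
  refine hno (hasCyc_of_fun (by omega) (fun i => p (if i = 0 then 0 else if i = 1 then 4 else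
    if i = 2 then 5 else if i = 3 then 1 else if i = 4 then 2 else (i + 1 : ℤ))) ?_ ?_ ?_)
  · intro i hi j hj hij
    have := h.inj hij (by split_ifs <;> omega) (by split_ifs <;> omega)
    split_ifs at this <;> omega
  · intro i hi
    rcases i with _ | _ | _ | _ | _ | i
    · simpa using h4' 0
    · simpa using h.adj 4
    · simpa using (h4' 1).symm
    · simpa using h.adj 1
    · simpa using h4' 2
    · have := h.adj ((i + 6 : ℕ) : ℤ)
      simp
      convert this using 2 <;> · push_cast; ring
  · have e1 : m - 1 - 1 ≠ 0 := by omega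
    have e2 : m - 1 - 1 ≠ 1 := by omega
    have e3 : m - 1 - 1 ≠ 2 := by omega
    have e4 : m - 1 - 1 ≠ 3 := by omega
    have e5 : m - 1 - 1 ≠ 4 := by omega
    simp only [e1, e2, e3, e4, e5, if_false, if_true]
    refine h.closes ?_
    omega

/-- If shortening an even monochromatic cycle by one vertex is impossible, chords joining
vertices at an even distance have the other colour. -/
lemma compl_adj_of_even (h : CycSeq G m p) {l : ℕ} (hm : m = 2 * l) (hl : 3 ≤ l)
    (hno : ¬ HasCyc G (m - 1)) (hno' : ¬ HasCyc Gᶜ (m - 1)) {x : ℤ} {d : ℕ}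
    (hd : 0 < d) (hdl : d < l) : Gᶜ.Adj (p x) (p (x + 2 * d)) := by
  have h2 : ∀ x, Gᶜ.Adj (p x) (p (x + 2)) := fun x =>
    (SimpleGraph.compl_adj _ _ _).2 ⟨h.ne (by omega) (by omega) (by omega),
      fun hh => hno (h.hasCyc_of_skip_chord (by omega) hh)⟩
  rw [SimpleGraph.compl_adj]
  refine ⟨h.ne (by omega) (by omega) (by omega), fun hred => ?_⟩
  have hd1 : d ≠ 1 := by
    rintro rfl
    exact ((SimpleGraph.compl_adj _ _ _).1 (h2 x)).2 (by simpa using hred)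
  have hdl1 : d ≠ l - 1 := by
    intro e
    have := h2 (x + 2 * d)
    rw [(h.eq_iff (x + 2 * d + 2) x).2 ⟨1, by omega⟩] at this
    exact ((SimpleGraph.compl_adj _ _ _).1 this).2 hred.symm
  have c1 : Gᶜ.Adj (p (x + 1)) (p (x + 2 * d + 2)) := by
    rw [SimpleGraph.compl_adj]
    refine ⟨h.ne (by omega) (by omega) (by omega), fun hh => hno ?_⟩
    refine h.hasCyc_of_parallel_chords (x := x) (y := 2 * d) (by omega) (by omega) ?_ ?_
    · simpa using hred
    · simpa using hh
  have c2 : Gᶜ.Adj (p (x - 1)) (p (x + 2 * d - 2)) := by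
    rw [SimpleGraph.compl_adj]
    refine ⟨h.ne (by omega) (by omega) (by omega), fun hh => hno ?_⟩
    refine h.neg.hasCyc_of_parallel_chords (x := -x) (y := 2 * l - 2 * d) (by omega)
      (by omega) ?_ ?_
    · simp only [neg_neg]
      rwa [(h.eq_iff (-(-x + (2 * l - 2 * d : ℕ))) (x + 2 * d)).2 ⟨-1, by omega⟩]
    · rw [(h.eq_iff (-(-x + (2 * l - 2 * d : ℕ) + 2)) (x + 2 * d - 2)).2 ⟨-1, by omega⟩,
        show -(-x + 1) = x - 1 by ring]
      exact hh
  refine hno' (hasCyc_of_fun (by omega) (fun i => p (if i < l then x + 1 + 2 * i else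
    x + 2 * d - 2 - 2 * (i - l))) ?_ ?_ ?_)
  · intro i hi j hj hij
    have := (h.eq_iff _ _).1 hij
    split_ifs at this with a b b
    · have := h.inj hij (by simp only [a, b, if_true]; omega)
        (by simp only [a, b, if_true]; omega)
      simp only [a, b, if_true] at this
      omega
    · obtain ⟨c, hc⟩ := this
      rw [hm] at hc
      push_cast at hc
      rw [mul_assoc] at hc
      omega
    · obtain ⟨c, hc⟩ := this
      rw [hm] at hc
      push_cast at hc
      rw [mul_assoc] at hc
      omega
    · have := h.inj hij (by simp only [a, b, if_false]; omega)
        (by simp only [a, b, if_false]; omega)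
      simp only [a, b, if_false] at this
      omega
  · intro i hi
    rcases lt_trichotomy (i + 1) l with hlt | heq | hgt
    · have e1 : i < l := by omega
      simp only [e1, hlt, if_true]
      convert h2 (x + 1 + 2 * i) using 2
      push_cast; ring
    · have e1 : i < l := by omega
      have e2 : ¬ i + 1 < l := by omega
      simp only [e1, e2, if_true, if_false]
      rw [(h.eq_iff (x + 1 + 2 * i) (x - 1)).2 ⟨1, by omega⟩]
      convert c2 using 2
      omega
    · have e1 : ¬ i < l := by omega
      have e2 : ¬ i + 1 < l := by omega
      simp only [e1, e2, if_false]
      convert (h2 (x + 2 * d - 2 - 2 * ((i + 1 : ℕ) - l))).symm using 2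
      push_cast; ring
  · have e1 : ¬ m - 1 - 1 < l := by omega
    have e2 : 0 < l := by omega
    simp only [e1, e2, if_false, if_true]
    convert c1.symm using 1
    · rw [h.eq_iff]
      exact ⟨-1, by omega⟩
    · simp

end CycSeq

end CyclicSequences

section Existence

open Finset

variable {V : Type*} {G : SimpleGraph V}

lemma exists_center_of_no_matching {r : V → V → Prop} {A B : Finset V} (hA : A.Nonempty)
    (h : ∀ a ∈ A, ∀ a' ∈ A, ∀ b ∈ B, ∀ b' ∈ B, a ≠ a' → b ≠ b' → r a b → ¬ r a' b') :
    (∃ a₀ ∈ A, ∀ a ∈ A, ∀ b ∈ B, a ≠ a₀ → ¬ r a b) ∨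
      ∃ b₀ ∈ B, ∀ a ∈ A, ∀ b ∈ B, b ≠ b₀ → ¬ r a b := by
  by_contra! hcon
  obtain ⟨hcon1, hcon2⟩ := hcon
  obtain ⟨a₁, ha₁⟩ := hA
  obtain ⟨a, ha, b, hb, -, hab⟩ := hcon1 a₁ ha₁
  obtain ⟨a', ha', b', hb', hne, hab'⟩ := hcon1 a ha
  have e : b' = b := by
    by_contra hbb
    exact h a ha a' ha' b hb b' hb' hne.symm (Ne.symm hbb) hab hab'
  subst e
  obtain ⟨c, hc, d, hd, hdb, hcd⟩ := hcon2 b' hb'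
  have e1 : c = a := by
    by_contra hh
    exact h c hc a ha d hd b' hb' hh hdb hcd hab
  have e2 : c = a' := by
    by_contra hh
    exact h c hc a' ha' d hd b' hb' hh hdb hcd hab'
  exact hne (e2.symm.trans e1)

lemma exists_complete_bipartite_of_cliques [DecidableEq V] {l : ℕ} (hl : 3 ≤ l) {A B : Finset V}
    (hA : #A = l) (hB : #B = l) (hAB : Disjoint A B)
    (hAc : ∀ x ∈ A, ∀ y ∈ A, x ≠ y → Gᶜ.Adj x y) (hBc : ∀ x ∈ B, ∀ y ∈ B, x ≠ y → Gᶜ.Adj x y)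
    (hno : ¬ HasCyc Gᶜ (2 * l - 1)) :
    ∃ A B : Finset V, #A = l - 1 ∧ #B = l ∧ Disjoint A B ∧ (∀ a ∈ A, ∀ b ∈ B, G.Adj a b) ∧
      (∀ x ∈ A, ∀ y ∈ A, x ≠ y → Gᶜ.Adj x y) ∧ (∀ x ∈ B, ∀ y ∈ B, x ≠ y → Gᶜ.Adj x y) := by
  have key : ∀ A B : Finset V, #A = l → #B = l → Disjoint A B →
      (∀ x ∈ A, ∀ y ∈ A, x ≠ y → Gᶜ.Adj x y) → (∀ x ∈ B, ∀ y ∈ B, x ≠ y → Gᶜ.Adj x y) →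
      (∃ a₀ ∈ A, ∀ a ∈ A, ∀ b ∈ B, a ≠ a₀ → ¬ Gᶜ.Adj a b) →
      ∃ A B : Finset V, #A = l - 1 ∧ #B = l ∧ Disjoint A B ∧ (∀ a ∈ A, ∀ b ∈ B, G.Adj a b) ∧
      (∀ x ∈ A, ∀ y ∈ A, x ≠ y → Gᶜ.Adj x y) ∧ (∀ x ∈ B, ∀ y ∈ B, x ≠ y → Gᶜ.Adj x y) := by
    rintro A B hA hB hAB hAc hBc ⟨a₀, ha₀, h0⟩
    refine ⟨A.erase a₀, B, by rw [card_erase_of_mem ha₀, hA], hB,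
      hAB.mono_left (erase_subset _ _), fun a ha b hb => ?_, fun x hx y hy =>
        hAc x (mem_of_mem_erase hx) y (mem_of_mem_erase hy), hBc⟩
    have := h0 a (mem_of_mem_erase ha) b hb (ne_of_mem_erase ha)
    rw [SimpleGraph.compl_adj] at this
    by_contra hh
    exact this ⟨fun e => disjoint_left.1 hAB (mem_of_mem_erase ha) (e ▸ hb), hh⟩
  have hAne : A.Nonempty := by rw [← card_pos]; omega
  rcases exists_center_of_no_matching (r := Gᶜ.Adj) (B := B) hAne (by
    intro a ha a' ha' b hb b' hb' hne hne' h1 h2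
    have p1 := pathIn_clique (l - 2) A hAc (by omega) ha ha' hne
    have p2 := pathIn_clique (l - 3) B hBc (by omega) hb' hb hne'.symm
    have := (p1.append p2 (by exact_mod_cast hAB) h2).hasCyc h1.symm
    rw [show l - 2 + 2 + (l - 3 + 2) = 2 * l - 1 by omega] at this
    exact hno this) with h | ⟨b₀, hb₀, h⟩
  · exact key A B hA hB hAB hAc hBc h
  · exact key B A hB hA hAB.symm hBc hAc
      ⟨b₀, hb₀, fun b hb a ha hne hh => h a ha b hb hne hh.symm⟩

lemma CycSeq.exists_complete_bipartite [DecidableEq V] {l : ℕ} (hl : 3 ≤ l) {p : ℤ → V}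
    (h : CycSeq G (2 * l) p) (hno : ¬ HasCyc G (2 * l - 1)) (hno' : ¬ HasCyc Gᶜ (2 * l - 1)) :
    ∃ A B : Finset V, #A = l - 1 ∧ #B = l ∧ Disjoint A B ∧ (∀ a ∈ A, ∀ b ∈ B, G.Adj a b) ∧
      (∀ x ∈ A, ∀ y ∈ A, x ≠ y → Gᶜ.Adj x y) ∧ (∀ x ∈ B, ∀ y ∈ B, x ≠ y → Gᶜ.Adj x y) := by
  have hcl : ∀ c : ℤ, ∀ i ∈ range l, ∀ j ∈ range l, p (c + 2 * i) ≠ p (c + 2 * j) →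
      Gᶜ.Adj (p (c + 2 * i)) (p (c + 2 * j)) := by
    intro c i hi j hj hne
    rw [mem_range] at hi hj
    rcases lt_trichotomy i j with hij | rfl | hij
    · have := h.compl_adj_of_even rfl hl hno hno' (x := c + 2 * i) (d := j - i)
        (by omega) (by omega)
      rwa [show c + 2 * i + 2 * (j - i : ℕ) = c + 2 * j by omega] at this
    · exact absurd rfl hne
    · have := h.compl_adj_of_even rfl hl hno hno' (x := c + 2 * j) (d := i - j)
        (by omega) (by omega)
      rw [show c + 2 * j + 2 * (i - j : ℕ) = c + 2 * i by omega] at this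
      exact this.symm
  have hcard : ∀ c : ℤ, #((range l).image fun i : ℕ => p (c + 2 * i)) = l := by
    intro c
    rw [card_image_of_injOn, card_range]
    intro i hi j hj hij
    simp only [coe_range, Set.mem_Iio] at hi hj
    have := h.inj hij (by omega) (by omega)
    omega
  refine exists_complete_bipartite_of_cliques hl (hcard 0) (hcard 1) ?_ ?_ ?_ hno'
  · rw [disjoint_left]
    intro v hv hv'
    obtain ⟨i, hi, rfl⟩ := mem_image.1 hv
    obtain ⟨j, hj, hij⟩ := mem_image.1 hv'
    obtain ⟨c, hc⟩ := (h.eq_iff _ _).1 hij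
    push_cast at hc
    rw [mul_assoc] at hc
    omega
  · intro x hx y hy hne
    obtain ⟨i, hi, rfl⟩ := mem_image.1 hx
    obtain ⟨j, hj, rfl⟩ := mem_image.1 hy
    exact hcl 0 i hi j hj hne
  · intro x hx y hy hne
    obtain ⟨i, hi, rfl⟩ := mem_image.1 hx
    obtain ⟨j, hj, rfl⟩ := mem_image.1 hy
    exact hcl 1 i hi j hj hne

/-- A red `K_{l-1,l}` with blue parts among `4 * l - 3` vertices. -/
lemma hasCyc_of_complete_bipartite [Fintype V] [DecidableEq V] {l : ℕ} (hl : 3 ≤ l)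
    (hV : Fintype.card V = 4 * l - 3) {A B : Finset V} (hA : #A = l - 1) (hB : #B = l)
    (hAB : Disjoint A B) (hred : ∀ a ∈ A, ∀ b ∈ B, G.Adj a b)
    (hBc : ∀ x ∈ B, ∀ y ∈ B, x ≠ y → Gᶜ.Adj x y) :
    HasCyc G (2 * l - 1) ∨ HasCyc Gᶜ (2 * l - 1) := by
  classical
  by_contra! hcon
  obtain ⟨hno, hno'⟩ := hcon
  set U : Finset V := (A ∪ B)ᶜ with hU
  have hUc : #U = 2 * l - 2 := by
    rw [hU, card_compl, card_union_of_disjoint hAB]; omega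
  have hUA : Disjoint U A := by
    rw [disjoint_left]; intro v hv hv'; simp [hU] at hv; exact hv.1 hv'
  have hUB : Disjoint U B := by
    rw [disjoint_left]; intro v hv hv'; simp [hU] at hv; exact hv.2 hv'
  have compl_of : ∀ {X : Finset V}, Disjoint U X → ∀ u ∈ U, ∀ x ∈ X, ¬ G.Adj u x → Gᶜ.Adj u x :=
    fun hX u hu x hx hn => (SimpleGraph.compl_adj _ _ _).2
      ⟨fun e => disjoint_left.1 hX hu (e ▸ hx), hn⟩
  have f1 : ∀ u ∈ U, (∀ a ∈ A, Gᶜ.Adj u a) ∨ ∀ b ∈ B, Gᶜ.Adj u b := by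
    intro u hu
    by_contra! hh
    obtain ⟨⟨a, ha, hua⟩, b, hb, hub⟩ := hh
    have hua' : G.Adj u a := by
      by_contra hn; exact hua (compl_of hUA u hu a ha hn)
    have hub' : G.Adj u b := by
      by_contra hn; exact hub (compl_of hUB u hu b hb hn)
    have p1 := pathIn_bipartite_even (G := G) (l - 2) A B hAB hred (by omega) (by omega) a ha b hb
    have p2 : PathIn G {u} 1 u u := PathIn.single rfl
    have := (p2.append p1 (by
      rw [Set.disjoint_singleton_left]
      rintro (hh | hh)
      · exact disjoint_left.1 hUA hu hh
      · exact disjoint_left.1 hUB hu hh) hua').hasCyc hub'.symm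
    rw [show 1 + 2 * (l - 2 + 1) = 2 * l - 1 by omega] at this
    exact hno this
  set UB := U.filter (fun u => ∀ b ∈ B, Gᶜ.Adj u b) with hUBd
  set UA := U.filter (fun u => ¬ ∀ b ∈ B, Gᶜ.Adj u b) with hUAd
  have hsum : #UB + #UA = #U := card_filter_add_card_filter_not _
  have hUAadj : ∀ u ∈ UA, ∀ a ∈ A, Gᶜ.Adj u a := by
    intro u hu
    rw [hUAd, mem_filter] at hu
    exact (f1 u hu.1).resolve_right hu.2
  have hUAU : UA ⊆ U := filter_subset _ _
  have f2 : #UB < l - 1 := by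
    by_contra! hh
    obtain ⟨b, hb, b', hb', hbb⟩ := one_lt_card.1 (show 1 < #B by omega)
    have p1 := pathIn_bipartite_odd (G := Gᶜ) (l - 2) B UB
      (hUB.symm.mono_right (filter_subset _ _))
      (fun x hx y hy => ((mem_filter.1 hy).2 x hx).symm) (by omega) (by omega) hb hb' hbb
    have := p1.hasCyc (hBc b' hb' b hb hbb.symm)
    rw [show 2 * (l - 2) + 3 = 2 * l - 1 by omega] at this
    exact hno' this
  have hUAc : l ≤ #UA := by omega
  have f3 : ∀ u ∈ UA, ∀ u' ∈ UA, u ≠ u' → G.Adj u u' := by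
    intro u hu u' hu' hne
    by_contra hn
    have p1 := pathIn_bipartite_odd (G := Gᶜ) (l - 2) UA A
      (hUA.mono_left hUAU) hUAadj (by omega) (by omega) hu hu' hne
    have := p1.hasCyc ((SimpleGraph.compl_adj _ _ _).2 ⟨hne.symm, fun e => hn e.symm⟩)
    rw [show 2 * (l - 2) + 3 = 2 * l - 1 by omega] at this
    exact hno' this
  have f4 : ∀ u ∈ UA, ∀ u' ∈ UA, ∀ b ∈ B, ∀ b' ∈ B, u ≠ u' → b ≠ b' → G.Adj u b →
      ¬ G.Adj u' b' := by
    intro u hu u' hu' b hb b' hb' hne hbb h1 h2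
    have p1 := pathIn_bipartite_odd (G := G) (l - 3) B A hAB.symm
      (fun x hx y hy => (hred y hy x hx).symm) (by omega) (by omega) hb hb' hbb
    have p2 := pathIn_clique 0 UA f3 (by omega) hu' hu hne.symm
    have := (p1.append p2 (by
      rw [Set.disjoint_left]
      rintro v (hv | hv) hv'
      · exact disjoint_left.1 hUB (hUAU hv') hv
      · exact disjoint_left.1 hUA (hUAU hv') hv) h2.symm).hasCyc h1
    rw [show 2 * (l - 3) + 3 + (0 + 2) = 2 * l - 1 by omega] at this
    exact hno this
  obtain ⟨U', B', hU', hB', hU'c, hB'c, hblue⟩ : ∃ U' B' : Finset V, U' ⊆ UA ∧ B' ⊆ B ∧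
      l - 1 ≤ #U' ∧ l - 1 ≤ #B' ∧ ∀ u ∈ U', ∀ b ∈ B', ¬ G.Adj u b := by
    rcases exists_center_of_no_matching (r := G.Adj) (B := B)
      (card_pos.1 (show 0 < #UA by omega)) f4 with ⟨a, ha, h⟩ | ⟨b, hb, h⟩
    · exact ⟨UA.erase a, B, erase_subset _ _, Subset.rfl, by rw [card_erase_of_mem ha]; omega,
        by omega, fun u hu b hb => h u (mem_of_mem_erase hu) b hb (ne_of_mem_erase hu)⟩
    · exact ⟨UA, B.erase b, Subset.rfl, erase_subset _ _, by omega,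
        by rw [card_erase_of_mem hb]; omega,
        fun u hu b hb => h u hu b (mem_of_mem_erase hb) (ne_of_mem_erase hb)⟩
  obtain ⟨u, hu, u', hu', hne⟩ := one_lt_card.1 (show 1 < #U' by omega)
  obtain ⟨a, ha⟩ : A.Nonempty := by rw [← card_pos]; omega
  obtain ⟨b, hb, b', hb', hbb⟩ := one_lt_card.1 (show 1 < #B' by omega)
  -- a blue cycle alternating between `U'` and `A`, except for one excursion to `B'`
  have hblue' : ∀ u ∈ U', ∀ b ∈ B', Gᶜ.Adj u b := fun u hu b hb =>
    compl_of hUB u (hUAU (hU' hu)) b (hB' hb) (hblue u hu b hb)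
  have hBclique : ∀ x ∈ B', ∀ y ∈ B', x ≠ y → Gᶜ.Adj x y := fun x hx y hy =>
    hBc x (hB' hx) y (hB' hy)
  have p1 := pathIn_bipartite_odd (G := Gᶜ) (l - 3) U' A (hUA.mono_left (hU'.trans hUAU))
    (fun x hx y hy => hUAadj x (hU' hx) y hy) (by omega) (by omega) hu hu' hne
  have p2 := pathIn_clique 0 B' hBclique (by omega) hb hb' hbb
  have := (p1.append p2 (by
      rw [Set.disjoint_left]
      rintro v (hv | hv) hv'
      · exact disjoint_left.1 hUB (hUAU (hU' hv)) (hB' hv')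
      · exact disjoint_left.1 hAB hv (hB' hv')) (hblue' u' hu' b hb)).hasCyc
      (hblue' u hu b' hb').symm
  rw [show 2 * (l - 3) + 3 + (0 + 2) = 2 * l - 1 by omega] at this
  exact hno' this

lemma hasCyc_of_hasCyc_ge [Fintype V] {k : ℕ} (hk : Odd k) (hk5 : 5 ≤ k)
    (hV : Fintype.card V = 2 * k - 1) (m : ℕ) : ∀ G : SimpleGraph V, k ≤ m → HasCyc G m →
      HasCyc G k ∨ HasCyc Gᶜ k := by
  classical
  induction m using Nat.strong_induction_on with
  | _ m ih =>
    intro G hkm hG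
    rcases hkm.eq_or_lt with rfl | hlt
    · exact Or.inl hG
    by_cases h1 : HasCyc G (m - 1)
    · exact ih (m - 1) (by omega) G (by omega) h1
    by_cases h2 : HasCyc Gᶜ (m - 1)
    · have := ih (m - 1) (by omega) Gᶜ (by omega) h2
      rwa [compl_compl, or_comm] at this
    obtain ⟨p, hp⟩ := hG.exists_cycSeq (by omega)
    obtain ⟨s, hs⟩ := hk
    rcases Nat.even_or_odd' m with ⟨l, rfl | rfl⟩
    · obtain ⟨A, B, hA, hB, hAB, hred, -, hBc⟩ :=
        hp.exists_complete_bipartite (by omega) h1 h2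
      by_cases hl : 2 * l = k + 1
      · have := hasCyc_of_complete_bipartite (by omega) (by omega) hA hB hAB hred hBc
        rwa [show 2 * l - 1 = k by omega] at this
      · obtain ⟨a, ha⟩ : A.Nonempty := by rw [← card_pos]; omega
        obtain ⟨b, hb⟩ : B.Nonempty := by rw [← card_pos]; omega
        have := (pathIn_bipartite_even (G := G) (l - 2) A B hAB hred (by omega) (by omega)
          a ha b hb).hasCyc (hred a ha b hb).symm
        exact ih _ (by omega) G (by omega) this
    · rcases hp.hasCyc_pred_of_odd ⟨l, rfl⟩ (by omega) with h | h
      · exact absurd h h1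
      · exact absurd h h2

/-- Every two-colouring of the complete graph on `2 * k - 1` vertices contains a monochromatic
cycle of length `k`, for odd `k ≥ 5`. -/
theorem hasCyc_or_hasCyc_compl [Fintype V] {k : ℕ} (hk : Odd k) (hk5 : 5 ≤ k)
    (hV : Fintype.card V = 2 * k - 1) (G : SimpleGraph V) : HasCyc G k ∨ HasCyc Gᶜ k := by
  classical
  have main : ∀ G : SimpleGraph V, (¬ ∀ l, IsCyc G l → l.length ≤ k - 1) →
      HasCyc G k ∨ HasCyc Gᶜ k := by
    intro G hG
    push Not at hG
    obtain ⟨l, hl, hlk⟩ := hG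
    exact hasCyc_of_hasCyc_ge hk hk5 hV l.length G (by omega) ⟨l, rfl, hl⟩
  by_cases h1 : ∀ l, IsCyc G l → l.length ≤ k - 1
  swap
  · exact main G h1
  by_cases h2 : ∀ l, IsCyc Gᶜ l → l.length ≤ k - 1
  swap
  · have := main Gᶜ h2
    rwa [compl_compl, or_comm] at this
  exfalso
  have hne : (univ : Finset V).Nonempty := by
    rw [← card_pos, card_univ]; omega
  have e1 := sum_degree_le_of_cycles_le (by omega) h1 univ hne
  have e2 := sum_degree_le_of_cycles_le (by omega) h2 univ hne
  have e3 : ∑ x : V, (#{y ∈ univ | G.Adj x y} + #{y ∈ univ | Gᶜ.Adj x y}) =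
      #(univ : Finset V) * (2 * k - 2) := by
    rw [← smul_eq_mul, ← sum_const]
    refine sum_congr rfl fun x _ => ?_
    have hx := G.degree_compl x
    have hd := G.degree_lt_card_verts x
    rw [← SimpleGraph.card_neighborFinset_eq_degree, ← SimpleGraph.card_neighborFinset_eq_degree,
      SimpleGraph.neighborFinset_eq_filter, SimpleGraph.neighborFinset_eq_filter] at hx
    rw [← SimpleGraph.card_neighborFinset_eq_degree, SimpleGraph.neighborFinset_eq_filter] at hd
    omega
  rw [sum_add_distrib, card_univ, hV] at e3
  rw [card_univ, hV] at e1 e2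
  obtain ⟨j, rfl⟩ : ∃ j, k = j + 1 := ⟨k - 1, by omega⟩
  have r1 : 2 * (j + 1) - 1 = 2 * j + 1 := by omega
  have r2 : 2 * (j + 1) - 2 = 2 * j := by omega
  rw [r1, Nat.add_sub_cancel, Nat.add_sub_cancel] at e1 e2
  rw [r1, r2] at e3
  nlinarith

end Existence

section Growing

open Finset

variable {V : Type*}

lemma exists_many_lists [DecidableEq V] {Inv : ℕ → List V → Prop} {D m : ℕ} {l₀ : List V}
    (h0 : Inv 0 l₀)
    (hstep : ∀ j < m, ∀ l, Inv j l → ∃ S : Finset V, D ≤ #S ∧ ∀ v ∈ S, Inv (j + 1) (v :: l)) :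
    ∃ F : Finset (List V), D ^ m ≤ #F ∧ ∀ l ∈ F, Inv m l := by
  induction m with
  | zero => exact ⟨{l₀}, by simp, by simpa using h0⟩
  | succ m ih =>
    obtain ⟨F, hF, hFI⟩ := ih fun j hj => hstep j (by omega)
    choose! S hS hSI using hstep m (by omega)
    refine ⟨F.biUnion fun l => (S l).image fun v => v :: l, ?_, ?_⟩
    · rw [card_biUnion]
      · calc D ^ (m + 1) = D ^ m * D := pow_succ _ _
          _ ≤ #F * D := Nat.mul_le_mul_right _ hF
          _ = ∑ l ∈ F, D := by simp
          _ ≤ _ := sum_le_sum fun l hl => by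
            rw [card_image_of_injective _ (fun _ _ h => (List.cons.inj h).1)]
            exact hS l (hFI l hl)
      · intro l _ l' _ hne
        rw [Function.onFun, disjoint_left]
        intro x hx hx'
        obtain ⟨v, -, rfl⟩ := mem_image.1 hx
        obtain ⟨v', -, h⟩ := mem_image.1 hx'
        exact hne (List.cons.inj h).2.symm
    · intro l hl
      simp only [mem_biUnion, mem_image] at hl
      obtain ⟨l', hl', v, hv, rfl⟩ := hl
      exact hSI l' (hFI l' hl') v hv

/-- The `i`-th entry, counted from the end, of the list belongs to `T i`. -/
def Matches (T : ℕ → Finset V) : List V → Prop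
  | [] => True
  | v :: l => v ∈ T l.length ∧ Matches T l

lemma Matches.card_filter_mem_le [DecidableEq V] {T : ℕ → Finset V} {A : Finset V} {l : List V}
    (h : Matches T l) :
    #{w ∈ A | w ∈ l} ≤ #{i ∈ range l.length | ¬ Disjoint (T i) A} := by
  induction l with
  | nil => simp
  | cons v l ih =>
    obtain ⟨hv, hl⟩ := h
    have ih := ih hl
    rw [List.length_cons, range_add_one, filter_insert]
    by_cases hvA : v ∈ A
    · rw [if_pos (not_disjoint_iff.2 ⟨v, hv, hvA⟩), card_insert_of_notMem (by simp)]
      have : {w ∈ A | w ∈ v :: l} ⊆ insert v {w ∈ A | w ∈ l} := by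
        intro w
        simp only [mem_filter, List.mem_cons, mem_insert]
        tauto
      exact (card_le_card this).trans ((card_insert_le _ _).trans (by omega))
    · have : {w ∈ A | w ∈ v :: l} ⊆ {w ∈ A | w ∈ l} := by
        intro w
        simp only [mem_filter, List.mem_cons]
        rintro ⟨h1, rfl | h2⟩
        · exact absurd h1 hvA
        · exact ⟨h1, h2⟩
      refine (card_le_card this).trans (ih.trans (card_le_card ?_))
      split_ifs
      · exact Subset.rfl
      · exact subset_insert _ _

lemma Matches.subset {T : ℕ → Finset V} {A : Finset V} (hT : ∀ i, T i ⊆ A) {l : List V}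
    (h : Matches T l) : ∀ v ∈ l, v ∈ A := by
  induction l with
  | nil => simp
  | cons w l ih =>
    intro v hv
    rcases List.mem_cons.1 hv with rfl | hv
    · exact hT _ h.1
    · exact ih h.2 v hv

/-- Many cycles can be embedded greedily along a sequence of targets. -/
lemma exists_many_isCyc [DecidableEq V] {G : SimpleGraph V} [DecidableRel G.Adj]
    {m D a b r : ℕ} {T : ℕ → Finset V} {v₀ : V} (hb : r + D ≤ b)
    (h0 : T 0 = {v₀}) (hstart : b ≤ #{w ∈ T 1 | G.Adj v₀ w})
    (hreg : ∀ j, 1 ≤ j → j < m → ∀ X ⊆ T (j + 1), a ≤ #X →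
      #{v ∈ T j | #{w ∈ X | G.Adj v w} < b} ≤ r)
    (hsize : ∀ j, 2 ≤ j → j ≤ m → #{i ∈ range j | ¬ Disjoint (T i) (T j)} + a ≤ #(T j))
    (hclose : ∀ v ∈ T m, G.Adj v v₀) :
    ∃ F : Finset (List V), D ^ m ≤ #F ∧ ∀ l ∈ F, l.length = m + 1 ∧ IsCyc G l ∧ Matches T l := by
  let Inv : ℕ → List V → Prop := fun j l => l.length = j + 1 ∧ l.Nodup ∧ l.IsChain G.Adj ∧
    l.getLast? = some v₀ ∧ Matches T l ∧
    (j < m → ∀ v ∈ l.head?, b ≤ #{w ∈ T (j + 1) | G.Adj v w ∧ w ∉ l})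
  have hI0 : Inv 0 [v₀] := by
    refine ⟨rfl, by simp, by simp, rfl, ⟨by simp [h0], trivial⟩, ?_⟩
    intro _ v hv
    obtain rfl : v₀ = v := by simpa using hv
    refine hstart.trans (card_le_card ?_)
    intro w
    simp only [mem_filter, List.mem_singleton]
    exact fun h => ⟨h.1, h.2, h.2.ne.symm⟩
  obtain ⟨F, hF, hFI⟩ := exists_many_lists (D := D) (m := m) hI0 (by
    intro j hj l hl
    obtain ⟨hlen, hnd, hch, hlast, hmat, hext⟩ := hl
    obtain ⟨h, t, rfl⟩ : ∃ h t, l = h :: t := List.exists_cons_of_length_eq_add_one hlen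
    have hC := hext hj h (by simp)
    have hne : ∀ v, (v :: h :: t).getLast? = some v₀ := by
      intro v
      rw [List.getLast?_cons_cons]
      exact hlast
    by_cases hjm : j + 1 < m
    · set X := {w ∈ T (j + 2) | w ∉ h :: t} with hX
      have hXa : a ≤ #X := by
        have h1 := hmat.card_filter_mem_le (A := T (j + 2))
        have h2 := hsize (j + 2) (by omega) (by omega)
        have h3 : #{w ∈ T (j + 2) | w ∈ h :: t} + #X = #(T (j + 2)) := by
          rw [hX]; convert card_filter_add_card_filter_not (fun w => w ∈ h :: t)
        have h4 : #{i ∈ range (h :: t).length | ¬ Disjoint (T i) (T (j + 2))} ≤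
            #{i ∈ range (j + 2) | ¬ Disjoint (T i) (T (j + 2))} :=
          card_le_card (filter_subset_filter _ (range_subset_range.2 (by omega)))
        omega
      have hr := hreg (j + 1) (by omega) hjm X (filter_subset _ _) hXa
      refine ⟨{w ∈ T (j + 1) | G.Adj h w ∧ w ∉ h :: t} \
        {v ∈ T (j + 1) | #{w ∈ X | G.Adj v w} < b}, ?_, ?_⟩
      · have := le_card_sdiff {v ∈ T (j + 1) | #{w ∈ X | G.Adj v w} < b}
          {w ∈ T (j + 1) | G.Adj h w ∧ w ∉ h :: t}
        omega
      · intro v hv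
        rw [mem_sdiff, mem_filter, mem_filter] at hv
        obtain ⟨⟨hvT, hvh, hvl⟩, hvX⟩ := hv
        refine ⟨by simp at hlen ⊢; omega, List.nodup_cons.2 ⟨hvl, hnd⟩, ?_, hne v, ?_, ?_⟩
        · exact List.isChain_cons_cons.2 ⟨hvh.symm, hch⟩
        · exact ⟨by rwa [hlen], hmat⟩
        · intro _ v' hv'
          obtain rfl : v = v' := by simpa using hv'
          have h5 : b ≤ #{w ∈ X | G.Adj v w} := by
            by_contra hh
            exact hvX ⟨hvT, by omega⟩
          refine h5.trans (card_le_card ?_)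
          intro w
          simp only [hX, mem_filter]
          rintro ⟨⟨h1, h2⟩, h3⟩
          refine ⟨h1, h3, ?_⟩
          rw [List.mem_cons, not_or]
          exact ⟨h3.ne.symm, h2⟩
    · refine ⟨{w ∈ T (j + 1) | G.Adj h w ∧ w ∉ h :: t}, by omega, fun v hv => ?_⟩
      rw [mem_filter] at hv
      obtain ⟨hvT, hvh, hvl⟩ := hv
      refine ⟨by simp at hlen ⊢; omega, List.nodup_cons.2 ⟨hvl, hnd⟩, ?_, hne v, ?_, ?_⟩
      · exact List.isChain_cons_cons.2 ⟨hvh.symm, hch⟩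
      · exact ⟨by rwa [hlen], hmat⟩
      · exact fun hh => absurd hh hjm)
  refine ⟨F, hF, fun l hl => ?_⟩
  obtain ⟨hlen, hnd, hch, hlast, hmat, -⟩ := hFI l hl
  refine ⟨hlen, ⟨hnd, hch, ?_⟩, hmat⟩
  intro x hx y hy
  rw [hlast] at hx
  obtain rfl : v₀ = x := by simpa using hx
  obtain ⟨h, t, rfl⟩ : ∃ h t, l = h :: t := List.exists_cons_of_length_eq_add_one hlen
  obtain rfl : h = y := by simpa using hy
  have : t.length = m := by simpa using hlen
  exact (hclose h (by rw [← this]; exact hmat.1)).symm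

end Growing

section NearClique

open Finset

variable {V : Type*}

lemma IsCyc.insert {G : SimpleGraph V} {l₁ l₂ : List V} {w : V} (h : IsCyc G (l₁ ++ l₂))
    (hw : w ∉ l₁ ++ l₂) (h1 : l₁ ≠ []) (h2 : l₂ ≠ []) (hw1 : ∀ x ∈ l₁.getLast?, G.Adj x w)
    (hw2 : ∀ x ∈ l₂.head?, G.Adj w x) : IsCyc G (l₁ ++ w :: l₂) := by
  obtain ⟨hnd, hch, hcl⟩ := h
  refine ⟨?_, ?_, ?_⟩
  · rw [List.nodup_middle, List.nodup_cons]
    exact ⟨hw, hnd⟩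
  · rw [List.isChain_append] at hch
    rw [List.isChain_append, List.isChain_cons]
    refine ⟨hch.1, ⟨hw2, hch.2.1⟩, ?_⟩
    intro x hx y hy
    obtain rfl : w = y := by simpa using hy
    exact hw1 x hx
  · intro x hx y hy
    refine hcl x ?_ y ?_
    · obtain ⟨u, t, rfl⟩ := List.exists_cons_of_ne_nil h2
      rw [List.getLast?_append_of_ne_nil _ (by simp)] at hx ⊢
      rwa [List.getLast?_cons_cons] at hx
    · obtain ⟨u, t, rfl⟩ := List.exists_cons_of_ne_nil h1
      simpa using hy

lemma card_filter_getD_le [DecidableEq V] {l : List V} (hl : l.Nodup) (p : V → Prop)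
    [DecidablePred p] (v : V) (s : ℕ → ℕ) (I : Finset ℕ) (hI : ∀ i ∈ I, s i < l.length)
    (hs : Set.InjOn s I) :
    #{i ∈ I | p (l.getD (s i) v)} ≤ #{x ∈ l.toFinset | p x} := by
  refine card_le_card_of_injOn (fun i => l.getD (s i) v) ?_ ?_
  · intro i hi
    simp only [coe_filter, Set.mem_ofPred_eq] at hi ⊢
    refine ⟨?_, hi.2⟩
    rw [List.getD_eq_getElem _ _ (hI i hi.1), List.mem_toFinset]
    exact List.getElem_mem _
  · intro i hi j hj hij
    simp only [coe_filter, Set.mem_ofPred_eq] at hi hj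
    simp only at hij
    rw [List.getD_eq_getElem _ _ (hI i hi.1), List.getD_eq_getElem _ _ (hI j hj.1)] at hij
    exact hs hi.1 hj.1 ((hl.getElem_inj_iff).1 hij)

/-- Inserting a new vertex into many cycles. -/
lemma exists_insert_isCyc [DecidableEq V] {G : SimpleGraph V} [DecidableRel G.Adj]
    {F : Finset (List V)} {S : Finset V} {w : V} {d e : ℕ} (hw : w ∉ S)
    (hF : ∀ l ∈ F, l.toFinset = S ∧ IsCyc G l) (hd : #{x ∈ S | ¬ G.Adj w x} ≤ d)
    (he : e + 2 * d + 1 ≤ #S) :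
    ∃ F' : Finset (List V), e * #F ≤ #F' ∧ ∀ l ∈ F', l.toFinset = insert w S ∧ IsCyc G l := by
  have hlen : ∀ l ∈ F, l.length = #S := fun l hl => by
    rw [← (hF l hl).1, List.toFinset_card_of_nodup (hF l hl).2.1]
  have hwl : ∀ l ∈ F, w ∉ l := fun l hl hh => hw (by
    rw [← (hF l hl).1]; exact List.mem_toFinset.2 hh)
  let bad : List V → Finset ℕ := fun l =>
    {i ∈ Ico 1 #S | ¬ G.Adj w (l.getD (i - 1) w)} ∪ {i ∈ Ico 1 #S | ¬ G.Adj w (l.getD i w)}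
  have hbad : ∀ l ∈ F, #(bad l) ≤ 2 * d := by
    intro l hl
    have h1 := card_filter_getD_le (hF l hl).2.1 (fun x => ¬ G.Adj w x) w (fun i => i - 1)
      (Ico 1 #S) (by intro i hi; rw [mem_Ico] at hi; rw [hlen l hl]; omega) (by
        intro i hi j hj hij
        simp only [coe_Ico, Set.mem_Ico] at hi hj hij
        omega)
    have h2 := card_filter_getD_le (hF l hl).2.1 (fun x => ¬ G.Adj w x) w (fun i => i)
      (Ico 1 #S) (by intro i hi; rw [mem_Ico] at hi; rw [hlen l hl]; omega) (by
        intro i hi j hj hij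
        exact hij)
    rw [(hF l hl).1] at h1 h2
    refine (card_union_le _ _).trans ?_
    omega
  have hsplit : ∀ l ∈ F, ∀ i ∈ Ico 1 #S \ bad l,
      IsCyc G (l.take i ++ w :: l.drop i) := by
    intro l hl i hi
    simp only [bad, mem_sdiff, mem_Ico, mem_union, mem_filter, not_or, not_and, not_not] at hi
    obtain ⟨hi, hi1, hi2⟩ := hi
    have hl' := hlen l hl
    have := (hF l hl).2
    rw [← List.take_append_drop i l] at this
    refine this.insert (by rw [List.take_append_drop]; exact hwl l hl) ?_ ?_ ?_ ?_
    · intro hh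
      have := congrArg List.length hh
      rw [List.length_take, List.length_nil] at this
      omega
    · intro hh
      have := congrArg List.length hh
      rw [List.length_drop, List.length_nil] at this
      omega
    · intro x hx
      have h1 := hi1 hi
      rw [List.getD_eq_getElem _ _ (by omega)] at h1
      have : (l.take i).getLast? = some l[i - 1] := by
        rw [List.getLast?_eq_getElem?, List.length_take, List.getElem?_take,
          if_pos (by omega), List.getElem?_eq_getElem (by omega)]
        congr 2
        omega
      rw [this] at hx
      obtain rfl : l[i - 1] = x := by simpa using hx
      exact h1.symm
    · intro x hx
      have h2 := hi2 hi
      rw [List.getD_eq_getElem _ _ (by omega)] at h2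
      rw [List.head?_drop, List.getElem?_eq_getElem (by omega)] at hx
      obtain rfl : l[i] = x := by simpa using hx
      exact h2
  refine ⟨F.biUnion fun l => (Ico 1 #S \ bad l).image fun i => l.take i ++ w :: l.drop i,
    ?_, ?_⟩
  · have hwt : ∀ l ∈ F, ∀ i, w ∉ l.take i := fun l hl i hh =>
      hwl l hl (List.mem_of_mem_take hh)
    rw [card_biUnion]
    · rw [mul_comm, ← smul_eq_mul]
      refine card_nsmul_le_sum _ _ _ fun l hl => ?_
      rw [card_image_of_injOn]
      · have h1 := le_card_sdiff (bad l) (Ico 1 #S)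
        have h2 := hbad l hl
        rw [Nat.card_Ico] at h1
        omega
      · intro i hi j hj hij
        simp only [coe_sdiff, coe_Ico, Set.mem_sdiff, Set.mem_Ico] at hi hj
        have := congrArg (List.idxOf w) hij
        simp only [List.idxOf_append_of_notMem (hwt l hl _), List.idxOf_cons_self,
          List.length_take, hlen l hl] at this
        omega
    · intro l hl l' hl' hne
      rw [Function.onFun, disjoint_left]
      intro x hx hx'
      obtain ⟨i, -, rfl⟩ := mem_image.1 hx
      obtain ⟨j, -, h⟩ := mem_image.1 hx'
      have := congrArg (fun y => List.erase y w) h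
      simp only [List.erase_append_right _ (hwt l hl _), List.erase_append_right _ (hwt l' hl' _),
        List.erase_cons_head, List.take_append_drop] at this
      exact hne this.symm
  · intro l' hl'
    simp only [mem_biUnion, mem_image] at hl'
    obtain ⟨l, hl, i, hi, rfl⟩ := hl'
    refine ⟨?_, hsplit l hl i hi⟩
    have : l.toFinset = (l.take i).toFinset ∪ (l.drop i).toFinset := by
      rw [← List.toFinset_append, List.take_append_drop]
    rw [← (hF l hl).1, this]
    simp

/-- Counting Hamiltonian cycles of a nearly complete graph. -/
lemma exists_many_isCyc_of_near_clique [DecidableEq V] {G : SimpleGraph V} [DecidableRel G.Adj]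
    {W : Finset V} {d e m : ℕ} (hd : ∀ v ∈ W, #{x ∈ W | ¬ G.Adj v x} ≤ d)
    (h1 : e + 2 * d + m ≤ #W) (h2 : e + 2 * d ≤ m) (h3 : m < #W) :
    ∃ F : Finset (List V), e ^ (#W - 1) ≤ 2 ^ #W * #F ∧ ∀ l ∈ F, l.length = #W ∧ IsCyc G l := by
  obtain ⟨v₀, hv₀⟩ : W.Nonempty := by rw [← card_pos]; omega
  have hcard : ∀ v ∈ W, ∀ X ⊆ W, #X ≤ #{x ∈ X | G.Adj v x} + d := by
    intro v hv X hX
    have := card_filter_add_card_filter_not (s := X) (fun x => G.Adj v x)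
    have h4 : #{x ∈ X | ¬ G.Adj v x} ≤ #{x ∈ W | ¬ G.Adj v x} :=
      card_le_card (filter_subset_filter _ hX)
    have := hd v hv
    omega
  have hN := hcard v₀ hv₀ W Subset.rfl
  obtain ⟨F₀, hF₀, hF₀'⟩ := exists_many_isCyc (G := G) (m := m) (D := e) (a := #W - d - m)
    (b := e) (r := 0) (T := fun j => if j = 0 then {v₀} else {x ∈ W | G.Adj v₀ x}) (v₀ := v₀)
    (by omega) rfl (by
      simp only [one_ne_zero, if_false, filter_filter, and_self]
      omega) (by
      intro j hj _ X hX ha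
      have hj0 : j ≠ 0 := by omega
      simp only [hj0, Nat.add_eq_zero_iff, one_ne_zero, and_false, if_false] at hX ⊢
      rw [Nat.le_zero, card_eq_zero, filter_eq_empty_iff]
      intro v hv
      have := hcard v (mem_filter.1 hv).1 X (hX.trans (filter_subset _ _))
      omega) (by
      intro j hj hjm
      have hj0 : j ≠ 0 := by omega
      have h5 : #{i ∈ range j | ¬ Disjoint (if i = 0 then {v₀} else {x ∈ W | G.Adj v₀ x})
          (if j = 0 then {v₀} else {x ∈ W | G.Adj v₀ x})} ≤ #(range j) := card_filter_le _ _
      rw [card_range] at h5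
      simp only [hj0, if_false] at h5 ⊢
      omega) (by
      intro v hv
      split_ifs at hv with hm
      · have := hd v₀ hv₀
        have h6 : 0 < #{x ∈ W | ¬ G.Adj v₀ x} := card_pos.2 ⟨v₀, by simp [hv₀]⟩
        omega
      · exact (mem_filter.1 hv).2.symm)
  have hF₀W : ∀ l ∈ F₀, l.toFinset ∈ W.powerset := by
    intro l hl
    rw [mem_powerset]
    intro v hv
    refine (hF₀' l hl).2.2.subset (A := W) ?_ v (List.mem_toFinset.1 hv)
    intro i
    split_ifs
    · simpa using hv₀
    · exact filter_subset _ _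
  obtain ⟨S, hS, hSmax⟩ := exists_max_image W.powerset (fun S => #{l ∈ F₀ | l.toFinset = S})
    ⟨∅, by simp⟩
  have hpig := card_le_mul_card_image_of_maps_to hF₀W _ hSmax
  rw [card_powerset] at hpig
  set F₁ := {l ∈ F₀ | l.toFinset = S} with hF₁
  have hins : ∀ R ⊆ W \ S, ∃ F : Finset (List V), e ^ #R * #F₁ ≤ #F ∧
      ∀ l ∈ F, l.toFinset = R ∪ S ∧ IsCyc G l := by
    intro R
    induction R using Finset.induction_on with
    | empty =>
      intro _
      refine ⟨F₁, by simp, fun l hl => ?_⟩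
      rw [hF₁, mem_filter] at hl
      simp [hl.2, (hF₀' l hl.1).2.1]
    | insert w R hwR ih =>
      intro hR
      obtain ⟨F, hF, hF'⟩ := ih ((subset_insert _ _).trans hR)
      rcases F₁.eq_empty_or_nonempty with he | ⟨l₁, hl₁⟩
      · exact ⟨∅, by simp [he], by simp⟩
      rw [hF₁, mem_filter] at hl₁
      have hSc : #S = m + 1 := by
        rw [← hl₁.2, List.toFinset_card_of_nodup (hF₀' l₁ hl₁.1).2.1.1, (hF₀' l₁ hl₁.1).1]
      have hwW := mem_sdiff.1 (hR (mem_insert_self w R))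
      have hRS : R ∪ S ⊆ W := union_subset
        (((subset_insert _ _).trans hR).trans sdiff_subset) (mem_powerset.1 hS)
      obtain ⟨F', h5, h6⟩ := exists_insert_isCyc (e := e) (d := d) (w := w)
        (by simp [hwR, hwW.2]) hF'
        ((card_le_card (filter_subset_filter _ hRS)).trans (hd w hwW.1)) (by
          have := card_le_card (subset_union_right (s₁ := R) (s₂ := S))
          omega)
      refine ⟨F', ?_, fun l hl => ?_⟩
      · rw [card_insert_of_notMem hwR, pow_succ, mul_comm _ e, mul_assoc]
        exact (Nat.mul_le_mul_left _ hF).trans h5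
      · rw [insert_union]
        exact h6 l hl
  obtain ⟨F, hF, hF'⟩ := hins _ Subset.rfl
  rw [sdiff_union_of_subset (mem_powerset.1 hS)] at hF'
  refine ⟨F, ?_, fun l hl => ⟨?_, (hF' l hl).2⟩⟩
  · rcases F₁.eq_empty_or_nonempty with he | ⟨l₁, hl₁⟩
    · rw [he] at hpig
      have : e ^ m = 0 := by simp at hpig; simp [hpig] at hF₀; simpa using hF₀
      obtain ⟨rfl, hm⟩ := pow_eq_zero_iff'.1 this
      rw [zero_pow (by omega)]
      exact Nat.zero_le _
    · rw [hF₁, mem_filter] at hl₁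
      have hSc : #S = m + 1 := by
        rw [← hl₁.2, List.toFinset_card_of_nodup (hF₀' l₁ hl₁.1).2.1.1, (hF₀' l₁ hl₁.1).1]
      have hc : #(W \ S) = #W - (m + 1) := by rw [card_sdiff_of_subset (mem_powerset.1 hS), hSc]
      calc e ^ (#W - 1) = e ^ #(W \ S) * e ^ m := by rw [← pow_add]; congr 1; omega
        _ ≤ e ^ #(W \ S) * (#F₁ * 2 ^ #W) := Nat.mul_le_mul_left _ (hF₀.trans hpig)
        _ = 2 ^ #W * (e ^ #(W \ S) * #F₁) := by ring
        _ ≤ _ := Nat.mul_le_mul_left _ hF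
  · rw [← List.toFinset_card_of_nodup (hF' l hl).2.1, (hF' l hl).1]

end NearClique

section Extremal

open Finset

variable {V : Type*}

lemma card_range_filter_odd_le (n : ℕ) : #{i ∈ range n | i % 2 = 1} ≤ n / 2 := by
  induction n with
  | zero => simp
  | succ n ih =>
    rw [range_add_one, filter_insert]
    split_ifs
    · exact (card_insert_le _ _).trans (by omega)
    · omega

lemma card_range_filter_even_le (n : ℕ) : #{i ∈ range n | i % 2 = 0} ≤ (n + 1) / 2 := by
  induction n with
  | zero => simp
  | succ n ih =>
    rw [range_add_one, filter_insert]
    split_ifs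
    · exact (card_insert_le _ _).trans (by omega)
    · omega

variable {G : SimpleGraph V} [DecidableRel G.Adj]

/-- Few vertices miss many vertices of the other side. -/
lemma exists_large_subset_of_sum_le {P Q : Finset V} {s : ℕ} (hs : 1 ≤ s)
    (h : ∑ x ∈ P, #{y ∈ Q | ¬ G.Adj x y} ≤ s ^ 2) :
    ∃ P' ⊆ P, #P ≤ #P' + s ∧ ∀ v ∈ P', #{y ∈ Q | ¬ G.Adj v y} ≤ s := by
  refine ⟨{v ∈ P | #{y ∈ Q | ¬ G.Adj v y} ≤ s}, filter_subset _ _, ?_,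
    fun v hv => (mem_filter.1 hv).2⟩
  have h1 := card_filter_add_card_filter_not (s := P) (fun v => #{y ∈ Q | ¬ G.Adj v y} ≤ s)
  have h2 : #{v ∈ P | ¬ #{y ∈ Q | ¬ G.Adj v y} ≤ s} * s ≤ s * s := by
    rw [← pow_two s]
    refine le_trans ?_ (le_trans (sum_le_sum_of_subset (filter_subset
      (fun v => ¬ #{y ∈ Q | ¬ G.Adj v y} ≤ s) P)) h)
    rw [← smul_eq_mul]
    refine card_nsmul_le_sum _ _ _ fun v hv => ?_
    have := (mem_filter.1 hv).2
    omega
  have := Nat.le_of_mul_le_mul_right h2 (by omega)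
  omega

variable [DecidableEq V]

/-- Odd cycles through a vertex with many neighbours on both sides of a nearly complete bipartite
graph. -/
lemma exists_many_isCyc_of_near_bipartite {P Q : Finset V} {z : V} {s k : ℕ} (hs : 1 ≤ s)
    (hk : Odd k) (hsk : 1000 * s ≤ k) (hPQ : Disjoint P Q)
    (hP : k ≤ #P + 3 * s) (hQ : k ≤ #Q + 3 * s)
    (hPd : ∀ v ∈ P, #{y ∈ Q | ¬ G.Adj v y} ≤ s) (hQd : ∀ v ∈ Q, #{y ∈ P | ¬ G.Adj v y} ≤ s)
    (hzP : 20 * s ≤ #{y ∈ P | G.Adj z y}) (hzQ : 20 * s ≤ #{y ∈ Q | G.Adj z y}) :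
    ∃ F : Finset (List V), s ^ (k - 1) ≤ #F ∧ ∀ l ∈ F, l.length = k ∧ IsCyc G l := by
  obtain ⟨R, hR, hRc⟩ := exists_subset_card_eq (show 2 * s ≤ #{y ∈ Q | G.Adj z y} by omega)
  have hRQ : R ⊆ Q := hR.trans (filter_subset _ _)
  have hRz : ∀ y ∈ R, G.Adj z y := fun y hy => (mem_filter.1 (hR hy)).2
  set T : ℕ → Finset V := fun j => if j = 0 then {z} else if j = k - 1 then R else
    if j % 2 = 1 then P.erase z else (Q \ R).erase z with hT
  have hk2 := Nat.odd_iff.1 hk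
  have hT0 : T 0 = {z} := by simp [hT]
  have hTm : T (k - 1) = R := by
    have : k - 1 ≠ 0 := by omega
    simp [hT, this]
  have hTodd : ∀ j, j % 2 = 1 → T j = P.erase z := by
    intro j hj
    have h1 : j ≠ 0 := by omega
    have h2 : j ≠ k - 1 := by omega
    simp [hT, h1, h2, hj]
  have hTeven : ∀ j, j % 2 = 0 → j ≠ 0 → j ≠ k - 1 → T j = (Q \ R).erase z := by
    intro j hj h1 h2
    have h3 : ¬ j % 2 = 1 := by omega
    simp [hT, h1, h2, h3]
  have hTevenQ : ∀ j, j % 2 = 0 → j ≠ 0 → T j ⊆ Q := by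
    intro j hj h1
    by_cases h2 : j = k - 1
    · rw [h2, hTm]; exact hRQ
    · rw [hTeven j hj h1 h2]
      exact (erase_subset _ _).trans sdiff_subset
  have hTz : ∀ j, j ≠ 0 → z ∉ T j := by
    intro j hj hz
    by_cases h2 : j = k - 1
    · rw [h2, hTm] at hz
      exact (hRz z hz).ne rfl
    · rcases Nat.mod_two_eq_zero_or_one j with h | h
      · rw [hTeven j h hj h2] at hz; simp at hz
      · rw [hTodd j h] at hz; simp at hz
  have hdisj : ∀ i j, i % 2 = 0 → j % 2 = 1 → Disjoint (T i) (T j) := by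
    intro i j hi hj
    by_cases h : i = 0
    · rw [h, hT0, disjoint_singleton_left]
      exact hTz j (by omega)
    · rw [hTodd j hj]
      exact hPQ.symm.mono (hTevenQ i hi h) (erase_subset _ _)
  have hne : ∀ v, ∀ X : Finset V, ∀ A : Finset V, X ⊆ A → #{y ∈ A | ¬ G.Adj v y} ≤ s →
      #X ≤ #{y ∈ X | G.Adj v y} + s := by
    intro v X A hXA hA
    have h1 := card_filter_add_card_filter_not (s := X) (fun y => G.Adj v y)
    have h2 : #{y ∈ X | ¬ G.Adj v y} ≤ #{y ∈ A | ¬ G.Adj v y} :=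
      card_le_card (filter_subset_filter _ hXA)
    omega
  obtain ⟨F, hF, hF'⟩ := exists_many_isCyc (G := G) (m := k - 1) (D := s) (a := 2 * s) (b := s)
    (r := 0) (T := T) (v₀ := z) (by omega) hT0 (by
      rw [hTodd 1 rfl]
      refine (show s ≤ 20 * s by omega).trans (hzP.trans (card_le_card ?_))
      intro y
      simp only [mem_filter, mem_erase]
      exact fun h => ⟨⟨h.2.ne.symm, h.1⟩, h.2⟩) (by
      intro j hj hjm X hX ha
      rw [Nat.le_zero, card_eq_zero, filter_eq_empty_iff]
      intro v hv
      rcases Nat.mod_two_eq_zero_or_one j with h | h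
      · have h1 := hTevenQ j h (by omega) hv
        rw [hTodd (j + 1) (by omega)] at hX
        have := hne v X P (hX.trans (erase_subset _ _)) (hQd v h1)
        omega
      · have h1 := hTevenQ (j + 1) (by omega) (by omega)
        rw [hTodd j h] at hv
        have := hne v X Q (hX.trans h1) (hPd v (mem_of_mem_erase hv))
        omega) (by
      intro j hj hjm
      by_cases hjk : j = k - 1
      · have : {i ∈ range j | ¬ Disjoint (T i) (T j)} = ∅ := by
          rw [filter_eq_empty_iff]
          intro i hi
          rw [mem_range] at hi
          rw [not_not]
          rcases Nat.mod_two_eq_zero_or_one i with h | h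
          · by_cases h0 : i = 0
            · rw [h0, hT0, disjoint_singleton_left]
              exact hTz j (by omega)
            · rw [hTeven i h h0 (by omega), hjk, hTm]
              exact sdiff_disjoint.mono_left (erase_subset _ _)
          · exact (hdisj j i (by omega) h).symm
        rw [this, hjk, hTm]
        simp [hRc]
      rcases Nat.mod_two_eq_zero_or_one j with h | h
      · have h1 : #{i ∈ range j | ¬ Disjoint (T i) (T j)} ≤ #{i ∈ range j | i % 2 = 0} := by
          refine card_le_card (monotone_filter_right _ fun i _ hi => ?_)
          by_contra hh
          exact hi (hdisj j i h (by omega)).symm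
        have h2 := card_range_filter_even_le j
        rw [hTeven j h (by omega) hjk] at h1 ⊢
        have h3 := pred_card_le_card_erase (s := Q \ R) (a := z)
        have h4 := le_card_sdiff R Q
        omega
      · have h1 : #{i ∈ range j | ¬ Disjoint (T i) (T j)} ≤ #{i ∈ range j | i % 2 = 1} := by
          refine card_le_card (monotone_filter_right _ fun i _ hi => ?_)
          by_contra hh
          exact hi (hdisj i j (by omega) h)
        have h2 := card_range_filter_odd_le j
        rw [hTodd j h] at h1 ⊢
        have h3 := pred_card_le_card_erase (s := P) (a := z)
        omega) (by
      intro v hv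
      rw [hTm] at hv
      exact (hRz v hv).symm)
  refine ⟨F, hF, fun l hl => ⟨?_, (hF' l hl).2.1⟩⟩
  rw [(hF' l hl).1]
  omega

/-- If one colour nearly contains a balanced complete bipartite graph, then there are many
monochromatic cycles. -/
theorem exists_many_isCyc_of_extremal [Fintype V] {P Q : Finset V} {s k : ℕ} (hs : 1 ≤ s)
    (hk : Odd k) (hsk : 1000 * s ≤ k) (hV : Fintype.card V = 2 * k - 1) (hPQ : Disjoint P Q)
    (hun : P ∪ Q = univ) (hP : k ≤ #P + s) (hQ : k ≤ #Q + s)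
    (hmiss : ∑ x ∈ P, #{y ∈ Q | ¬ G.Adj x y} ≤ s ^ 2) :
    ∃ F : Finset (List V), s ^ (k - 1) ≤ 2 ^ k * #F ∧
      ((∀ l ∈ F, l.length = k ∧ IsCyc G l) ∨ (∀ l ∈ F, l.length = k ∧ IsCyc Gᶜ l)) := by
  have hmiss' : ∑ x ∈ Q, #{y ∈ P | ¬ G.Adj x y} ≤ s ^ 2 := by
    have := sum_card_bipartiteAbove_eq_sum_card_bipartiteBelow (s := P) (t := Q)
      (fun x y => ¬ G.Adj x y)
    unfold bipartiteAbove bipartiteBelow at this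
    rw [this] at hmiss
    refine le_trans (le_of_eq (sum_congr rfl fun x _ => ?_)) hmiss
    congr 1
    ext y
    simp [G.adj_comm]
  obtain ⟨P', hP'P, hP', hPd⟩ := exists_large_subset_of_sum_le hs hmiss
  obtain ⟨Q', hQ'Q, hQ', hQd⟩ := exists_large_subset_of_sum_le hs hmiss'
  have hPd' : ∀ v ∈ P', #{y ∈ Q' | ¬ G.Adj v y} ≤ s := fun v hv =>
    (card_le_card (filter_subset_filter _ hQ'Q)).trans (hPd v hv)
  have hQd' : ∀ v ∈ Q', #{y ∈ P' | ¬ G.Adj v y} ≤ s := fun v hv =>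
    (card_le_card (filter_subset_filter _ hP'P)).trans (hQd v hv)
  by_cases hz : ∃ z, 20 * s ≤ #{y ∈ P' | G.Adj z y} ∧ 20 * s ≤ #{y ∈ Q' | G.Adj z y}
  · obtain ⟨z, hzP, hzQ⟩ := hz
    obtain ⟨F, hF, hF'⟩ := exists_many_isCyc_of_near_bipartite hs hk hsk (hPQ.mono hP'P hQ'Q)
      (by omega) (by omega) hPd' hQd' hzP hzQ
    exact ⟨F, hF.trans (Nat.le_mul_of_pos_left _ (by positivity)), Or.inl hF'⟩
  push Not at hz
  have key : ∀ A A₀ B B₀ : Finset V, A₀ ∪ B₀ = univ → B ⊆ B₀ → #B₀ ≤ #B + s → A ⊆ A₀ →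
      #A₀ ≤ #A + s → k ≤ #A₀ + s →
      (∀ v ∈ B, #{y ∈ A | ¬ G.Adj v y} ≤ s) →
      k ≤ #{v | #{y ∈ A | G.Adj v y} < 20 * s} →
      ∃ F : Finset (List V), s ^ (k - 1) ≤ 2 ^ k * #F ∧
        ∀ l ∈ F, l.length = k ∧ IsCyc Gᶜ l := by
    intro A A₀ B B₀ hAB hBB hBc hAA hAc hA hBd hW
    obtain ⟨W, hWs, hWc⟩ := exists_subset_card_eq hW
    have hWA : W \ A ⊆ (A₀ \ A) ∪ (B₀ \ B) := by
      intro x hx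
      obtain ⟨hxW, hxA⟩ := mem_sdiff.1 hx
      by_cases hxA₀ : x ∈ A₀
      · exact mem_union_left _ (mem_sdiff.2 ⟨hxA₀, hxA⟩)
      have hxB₀ : x ∈ B₀ := by
        have := mem_univ x
        rw [← hAB] at this
        exact (mem_union.1 this).resolve_left hxA₀
      refine mem_union_right _ (mem_sdiff.2 ⟨hxB₀, fun hxB => ?_⟩)
      have h1 := hBd x hxB
      have h2 := (mem_filter.1 (hWs hxW)).2
      have h3 := card_filter_add_card_filter_not (s := A) (fun y => G.Adj x y)
      omega
    have hWA' := (card_le_card hWA).trans (card_union_le _ _)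
    rw [card_sdiff_of_subset hBB, card_sdiff_of_subset hAA] at hWA'
    have hd : ∀ v ∈ W, #{x ∈ W | ¬ Gᶜ.Adj v x} ≤ 22 * s := by
      intro v hv
      have hsub : {x ∈ W | ¬ Gᶜ.Adj v x} ⊆ insert v ({y ∈ A | G.Adj v y} ∪ W \ A) := by
        intro x
        simp only [mem_filter, mem_insert, mem_union, mem_sdiff, SimpleGraph.compl_adj, not_and,
          not_not]
        rintro ⟨h1, h2⟩
        by_cases hvx : v = x
        · exact Or.inl hvx.symm
        · by_cases hxA : x ∈ A
          · exact Or.inr (Or.inl ⟨hxA, h2 hvx⟩)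
          · exact Or.inr (Or.inr ⟨h1, hxA⟩)
      have h1 := card_le_card hsub
      have h2 := card_insert_le v ({y ∈ A | G.Adj v y} ∪ W \ A)
      have h3 := card_union_le {y ∈ A | G.Adj v y} (W \ A)
      have h4 := (mem_filter.1 (hWs hv)).2
      omega
    have := exists_many_isCyc_of_near_clique (G := Gᶜ) (e := s) (m := k / 2) hd
      (by omega) (by omega) (by omega)
    rwa [hWc] at this
  have hcov : 2 * k - 1 ≤ #{v | #{y ∈ P' | G.Adj v y} < 20 * s} +
      #{v | #{y ∈ Q' | G.Adj v y} < 20 * s} := by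
    rw [← hV, ← card_univ]
    refine le_trans (card_le_card fun v _ => ?_) (card_union_le _ _)
    rw [mem_union, mem_filter, mem_filter]
    by_cases h : 20 * s ≤ #{y ∈ P' | G.Adj v y}
    · exact Or.inr ⟨mem_univ _, hz v h⟩
    · exact Or.inl ⟨mem_univ _, by omega⟩
  have hun' : Q ∪ P = univ := by rw [union_comm, hun]
  by_cases h : k ≤ #{v | #{y ∈ P' | G.Adj v y} < 20 * s}
  · obtain ⟨F, hF, hF'⟩ := key P' P Q' Q hun hQ'Q hQ' hP'P hP' hP hQd' h
    exact ⟨F, hF, Or.inr hF'⟩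
  · obtain ⟨F, hF, hF'⟩ := key Q' Q P' P hun' hP'P hP' hQ'Q hQ' hQ hPd' (by omega)
    exact ⟨F, hF, Or.inr hF'⟩

end Extremal

section ClusterWalk

open Finset

variable {V ι : Type*}

/-- A closed walk in a cluster graph which does not visit any cluster too often can be lifted to
many cycles of the same length. -/
lemma exists_many_isCyc_of_cluster_walk [DecidableEq V] [DecidableEq ι] {G : SimpleGraph V}
    [DecidableRel G.Adj] {H : SimpleGraph ι} {fib : ι → Finset V} {c : ℕ → ι} {m M D a b r : ℕ}
    (hfib : ∀ i j, i ≠ j → Disjoint (fib i) (fib j)) (hM : ∀ i, M ≤ #(fib i))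
    (hreg : ∀ i j, H.Adj i j → ∀ X ⊆ fib j, a ≤ #X →
      #{v ∈ fib i | #{w ∈ X | G.Adj v w} < b} ≤ r)
    (hdeg : ∀ i j, H.Adj i j → #{v ∈ fib i | #{w ∈ fib j | G.Adj v w} < 2 * a} ≤ r)
    (hb : r + D ≤ b) (hba : b ≤ a) (hr : 2 * r < M) (hm : 2 ≤ m)
    (hc : ∀ j < m, H.Adj (c j) (c (j + 1))) (hcm : H.Adj (c m) (c 0))
    (hcount : ∀ i, #{j ∈ range (m + 1) | c j = i} + 2 * a + 1 ≤ M) :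
    ∃ F : Finset (List V), D ^ m ≤ #F ∧ ∀ l ∈ F, l.length = m + 1 ∧ IsCyc G l := by
  obtain ⟨v₀, hv₀, hn1, hnm⟩ : ∃ v ∈ fib (c 0), 2 * a ≤ #{w ∈ fib (c 1) | G.Adj v w} ∧
      2 * a ≤ #{w ∈ fib (c m) | G.Adj v w} := by
    by_contra! hcon
    have h1 := hdeg _ _ (hc 0 (by lia))
    have h2 := hdeg _ _ hcm.symm
    have h3 : fib (c 0) ⊆ {v ∈ fib (c 0) | #{w ∈ fib (c (0 + 1)) | G.Adj v w} < 2 * a} ∪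
        {v ∈ fib (c 0) | #{w ∈ fib (c m) | G.Adj v w} < 2 * a} := by
      intro v hv
      by_cases h : 2 * a ≤ #{w ∈ fib (c 1) | G.Adj v w}
      · exact mem_union_right _ (mem_filter.2 ⟨hv, hcon v hv h⟩)
      · exact mem_union_left _ (mem_filter.2 ⟨hv, not_le.1 h⟩)
    have h4 := (card_le_card h3).trans (card_union_le _ _)
    have h5 := hM (c 0)
    lia
  obtain ⟨R, hR, hRa⟩ := exists_subset_card_eq (show a ≤ #{w ∈ fib (c m) | G.Adj v₀ w} by lia)
  have hRadj : ∀ w ∈ R, G.Adj v₀ w := fun w hw => (mem_filter.1 (hR hw)).2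
  have hv₀R : v₀ ∉ R := fun h => (hRadj _ h).ne rfl
  let T : ℕ → Finset V := fun j =>
    if j = 0 then {v₀} else if j = m then R else fib (c j) \ insert v₀ R
  have hT0 : T 0 = {v₀} := if_pos rfl
  have hTm : T m = R := by simp [T, show m ≠ 0 by lia]
  have hTj : ∀ j, 1 ≤ j → j < m → T j = fib (c j) \ insert v₀ R := by
    intro j h1 h2
    simp [T, show j ≠ 0 by lia, show j ≠ m by lia]
  have hTfib : ∀ j ≤ m, T j ⊆ fib (c j) := by
    intro j hj
    rcases Nat.eq_zero_or_pos j with rfl | h0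
    · rw [hT0]; simpa using hv₀
    rcases hj.eq_or_lt with rfl | h
    · rw [hTm]; exact hR.trans (filter_subset _ _)
    · rw [hTj j h0 h]; exact sdiff_subset
  obtain ⟨F, hF, hF'⟩ := exists_many_isCyc (G := G) (m := m) (T := T) (a := a) hb hT0 (by
    rw [hTj 1 le_rfl (by lia)]
    have h1 : {w ∈ fib (c 1) | G.Adj v₀ w} \ R ⊆
        {w ∈ fib (c 1) \ insert v₀ R | G.Adj v₀ w} := by
      intro w
      simp only [mem_sdiff, mem_filter, mem_insert, not_or]
      exact fun h => ⟨⟨h.1.1, h.1.2.ne.symm, h.2⟩, h.1.2⟩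
    have h2 := card_le_card h1
    have h3 := le_card_sdiff R {w ∈ fib (c 1) | G.Adj v₀ w}
    lia) (by
    intro j h1 h2 X hX haX
    refine (card_le_card ?_).trans (hreg _ _ (hc j h2) X (hX.trans (hTfib _ h2)) haX)
    exact filter_subset_filter _ (hTfib _ h2.le)) (by
    intro j h2 hj
    rcases hj.eq_or_lt with rfl | h
    · rw [hTm, filter_false_of_mem, card_empty, zero_add, hRa]
      intro i hi
      rw [not_not]
      rcases Nat.eq_zero_or_pos i with rfl | h0
      · rw [hT0]; simpa using hv₀R
      · rw [hTj i h0 (mem_range.1 hi)]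
        exact disjoint_of_subset_right (subset_insert _ _) sdiff_disjoint
    · rw [hTj j (by lia) h]
      have h3 : #{i ∈ range j | ¬ Disjoint (T i) (fib (c j) \ insert v₀ R)} ≤
          #{i ∈ range (m + 1) | c i = c j} := by
        refine card_le_card fun i => ?_
        simp only [mem_filter, mem_range]
        rintro ⟨hi, hd⟩
        refine ⟨by lia, ?_⟩
        by_contra hne
        exact hd (disjoint_of_subset_left (hTfib i (by lia))
          (disjoint_of_subset_right sdiff_subset (hfib _ _ hne)))
      have h4 := le_card_sdiff (insert v₀ R) (fib (c j))
      have h5 := card_insert_le v₀ R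
      have h6 := hcount (c j)
      have h7 := hM (c j)
      lia) (by
    rw [hTm]
    exact fun v hv => (hRadj v hv).symm)
  exact ⟨F, hF, fun l hl => ⟨(hF' l hl).1, (hF' l hl).2.1⟩⟩

variable {H : SimpleGraph ι}

lemma exists_sum_eq_of_le_card_mul [DecidableEq ι] (S : Finset ι) {N cap : ℕ} (h : N ≤ #S * cap) :
    ∃ f : ι → ℕ, (∀ i, f i ≤ cap) ∧ ∑ i ∈ S, f i = N := by
  induction S using Finset.induction_on generalizing N with
  | empty => exact ⟨0, by simp, by simp at h; simp [h]⟩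
  | insert x S hx ih =>
    rw [card_insert_of_notMem hx, add_one_mul] at h
    obtain ⟨f, hf, hs⟩ := ih (N := N - min N cap) (by lia)
    refine ⟨Function.update f x (min N cap), fun i => ?_, ?_⟩
    · by_cases hi : i = x
      · subst hi; simp
      · simpa [hi] using hf i
    · rw [sum_insert hx, Function.update_self, sum_update_of_notMem hx, hs]
      lia

lemma exists_winding_walk [DecidableEq ι] {v w : ι} (h : H.Adj v w) (n : ℕ) :
    ∃ p : H.Walk v v, p.length = 2 * n ∧
      ∀ i, p.support.tail.count i ≤ (if i = v then n else 0) + if i = w then n else 0 := by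
  induction n with
  | zero => exact ⟨.nil, rfl, by simp⟩
  | succ n ih =>
    obtain ⟨p, hp, hc⟩ := ih
    refine ⟨.cons h (.cons h.symm p), by simp [hp]; ring, fun i => ?_⟩
    have := hc i
    have hvw := h.ne
    rw [SimpleGraph.Walk.support_cons, List.tail_cons, SimpleGraph.Walk.support_cons,
      ← SimpleGraph.Walk.cons_tail_support, List.count_cons, List.count_cons]
    split_ifs at this ⊢ <;> simp_all

lemma count_tail_support_append [DecidableEq ι] {u v w : ι} (p : H.Walk u v) (q : H.Walk v w)
    (i : ι) : (p.append q).support.tail.count i =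
      p.support.tail.count i + q.support.tail.count i := by
  rw [SimpleGraph.Walk.tail_support_append, List.count_append]

lemma count_tail_support_le [DecidableEq ι] {u v : ι} (p : H.Walk u v) (i : ι) :
    p.support.tail.count i ≤ p.length := by
  refine List.count_le_length.trans ?_
  simp

/-- Closed walks of any prescribed odd length, balanced between the clusters. -/
lemma exists_balanced_walk [Fintype ι] [DecidableEq ι] {x₀ : ι} {S : Finset ι} {f : ι → ι}
    (hS : ∀ v ∈ S, H.Reachable x₀ v) (hf : Set.InjOn f S) (hadj : ∀ v ∈ S, H.Adj v (f v))
    {q : H.Walk x₀ x₀} (hq : Odd q.length) {k cap B : ℕ} (hk : Odd k)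
    (hB : q.length + #S * (2 * Fintype.card ι) ≤ B) (hBk : B ≤ k) (hcap : k ≤ 2 * (#S * cap)) :
    ∃ p : H.Walk x₀ x₀, p.length = k ∧ ∀ i, p.support.tail.count i ≤ 2 * cap + B := by
  have hdist : ∀ v, ∃ d ≤ Fintype.card ι, v ∈ S → ∃ p : H.Walk x₀ v, p.length = d := by
    intro v
    by_cases hv : v ∈ S
    · obtain ⟨p⟩ := hS v hv
      exact ⟨_, p.toPath.2.length_lt.le, fun _ => ⟨p.toPath, rfl⟩⟩
    · exact ⟨0, Nat.zero_le _, fun h => absurd h hv⟩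
  choose d hd hdp using hdist
  have hdsum : ∑ v ∈ S, 2 * d v ≤ #S * (2 * Fintype.card ι) := by
    rw [← smul_eq_mul]
    exact sum_le_card_nsmul _ _ _ fun v _ => by have := hd v; lia
  obtain ⟨e, he⟩ : ∃ e, k = q.length + ∑ v ∈ S, 2 * d v + 2 * e := by
    rw [← mul_sum] at hdsum ⊢
    obtain ⟨u, hu⟩ := hk
    obtain ⟨u', hu'⟩ := hq
    exact ⟨u - u' - ∑ v ∈ S, d v, by lia⟩
  obtain ⟨n, hn, hsum⟩ := exists_sum_eq_of_le_card_mul S (N := e) (cap := cap) (by lia)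
  have key : ∀ S' ⊆ S, ∃ p : H.Walk x₀ x₀,
      p.length = q.length + ∑ v ∈ S', 2 * d v + 2 * ∑ v ∈ S', n v ∧
      ∀ i, p.support.tail.count i ≤ q.length + ∑ v ∈ S', 2 * d v +
        ((if i ∈ S' then cap else 0) + if i ∈ S'.image f then cap else 0) := by
    intro S'
    induction S' using Finset.induction_on with
    | empty => exact fun _ => ⟨q, by simp, fun i => by simpa using count_tail_support_le q i⟩
    | insert v S' hv ih =>
      intro hsub
      obtain ⟨p, hp, hpc⟩ := ih ((subset_insert _ _).trans hsub)
      have hvS := hsub (mem_insert_self v S')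
      obtain ⟨w, hw, hwc⟩ := exists_winding_walk (hadj v hvS) (n v)
      obtain ⟨t, ht⟩ := hdp v hvS
      refine ⟨((p.append t).append w).append t.reverse, ?_, fun i => ?_⟩
      · rw [sum_insert hv, sum_insert hv]
        simp only [SimpleGraph.Walk.length_append, SimpleGraph.Walk.length_reverse, hp, hw, ht]
        ring
      · rw [count_tail_support_append, count_tail_support_append, count_tail_support_append,
          sum_insert hv]
        have h1 := hpc i
        have h2 := hwc i
        have h3 := count_tail_support_le t i
        have h4 := count_tail_support_le t.reverse i
        rw [SimpleGraph.Walk.length_reverse] at h4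
        have hnv := hn v
        have h5 : (if i = v then n v else 0) + (if i ∈ S' then cap else 0) ≤
            if i ∈ insert v S' then cap else 0 := by
          by_cases hi : i = v
          · subst hi; simp [hv, hnv]
          · simp [hi]
        have h6 : (if i = f v then n v else 0) + (if i ∈ S'.image f then cap else 0) ≤
            if i ∈ (insert v S').image f then cap else 0 := by
          rw [image_insert]
          by_cases hi : i = f v
          · subst hi
            have : f v ∉ S'.image f := by
              intro h
              obtain ⟨u, hu, huv⟩ := mem_image.1 h
              exact hv (hf (hsub (mem_insert_of_mem hu)) hvS huv ▸ hu)
            simp [this, hnv]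
          · simp [hi]
        lia
  obtain ⟨p, hp, hpc⟩ := key S Subset.rfl
  refine ⟨p, by rw [hp, hsum, he], fun i => (hpc i).trans ?_⟩
  split_ifs <;> lia

lemma SimpleGraph.Walk.card_filter_getVert_eq [DecidableEq ι] {u v : ι} (p : H.Walk u v) (i : ι) :
    #{j ∈ range p.length | p.getVert (j + 1) = i} = p.support.tail.count i := by
  induction p with
  | nil => rfl
  | cons h p ih =>
    rw [card_filter] at ih
    rw [SimpleGraph.Walk.length_cons, card_filter, sum_range_succ', SimpleGraph.Walk.support_cons,
      List.tail_cons, ← SimpleGraph.Walk.cons_tail_support p, List.count_cons, ← ih]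
    refine congrArg₂ _ rfl ?_
    simp

end ClusterWalk

section ClusterStability

open Finset

variable {ι : Type*} [Fintype ι] [DecidableEq ι] {H : SimpleGraph ι} [DecidableRel H.Adj]

/-- A defect version of Hall's theorem, for the neighbourhoods in a graph. -/
lemma exists_injOn_adj_or_deficient {X : Finset ι} {s : ℕ} (hs : s ≤ #X) :
    (∃ S ⊆ X, s ≤ #S ∧ ∃ f : ι → ι, Set.InjOn f S ∧ ∀ v ∈ S, H.Adj v (f v)) ∨
      ∃ I ⊆ X, #(I.biUnion fun v => H.neighborFinset v) + (#X - s) < #I := by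
  let t : X → Finset (ι ⊕ Fin (#X - s)) := fun v => (H.neighborFinset v).disjSum univ
  by_cases h : ∀ S : Finset X, #S ≤ #(S.biUnion t)
  · left
    obtain ⟨g, hg, hgt⟩ := (all_card_le_biUnion_card_iff_exists_injective t).1 h
    have hmem : ∀ (v : X) (w : ι), g v = Sum.inl w → H.Adj v w := by
      intro v w hvw
      have := hgt v
      rw [hvw] at this
      simpa [t] using this
    let L : Finset X := univ.filter fun v => (g v).isLeft
    have hLc : #{v : X | ¬ (g v).isLeft} ≤ #X - s := by
      have : (({v : X | ¬ (g v).isLeft} : Finset X).image g) ⊆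
          (univ : Finset (Fin (#X - s))).map Function.Embedding.inr := by
        intro z hz
        obtain ⟨v, hv, rfl⟩ := mem_image.1 hz
        rw [mem_filter] at hv
        rcases hgv : g v with w | w
        · simp [hgv] at hv
        · simp
      have h2 := card_le_card this
      rwa [card_image_of_injective _ hg, card_map, card_univ, Fintype.card_fin] at h2
    have hL : s ≤ #L := by
      have := card_filter_add_card_filter_not (s := (univ : Finset X)) fun v => (g v).isLeft
      rw [card_univ, Fintype.card_coe] at this
      change #L + _ = _ at this
      lia
    let f : ι → ι := fun v => if hv : v ∈ X then (g ⟨v, hv⟩).elim id (fun _ => v) else v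
    have hf : ∀ v : X, v ∈ L → g v = Sum.inl (f v) := by
      intro v hv
      rcases hgv : g v with w | w
      · simp [f, hgv]
      · simp [L, hgv] at hv
    refine ⟨L.map (Function.Embedding.subtype _), ?_, by rwa [card_map], f, ?_, ?_⟩
    · intro v hv
      obtain ⟨u, -, rfl⟩ := mem_map.1 hv
      exact u.2
    · intro v hv w hw hvw
      obtain ⟨u, hu, rfl⟩ := mem_map.1 hv
      obtain ⟨u', hu', rfl⟩ := mem_map.1 hw
      have : g u = g u' := by rw [hf u hu, hf u' hu']; exact congrArg _ hvw
      rw [hg this]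
    · intro v hv
      obtain ⟨u, hu, rfl⟩ := mem_map.1 hv
      exact hmem _ _ (hf u hu)
  · right
    push Not at h
    obtain ⟨S, hS⟩ := h
    have hS0 : S.Nonempty := by
      by_contra h0
      rw [not_nonempty_iff_eq_empty] at h0
      simp [h0] at hS
    refine ⟨S.map (Function.Embedding.subtype _), ?_, ?_⟩
    · intro v hv
      obtain ⟨u, -, rfl⟩ := mem_map.1 hv
      exact u.2
    · rw [card_map]
      refine lt_of_le_of_lt ?_ hS
      have : ((S.map (Function.Embedding.subtype _)).biUnion
          fun v => H.neighborFinset v).disjSum (univ : Finset (Fin (#X - s))) ⊆ S.biUnion t := by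
        intro z hz
        rcases z with w | w
        · simp only [inl_mem_disjSum, mem_biUnion, mem_map] at hz
          obtain ⟨_, ⟨u, hu, rfl⟩, hw⟩ := hz
          exact mem_biUnion.2 ⟨u, hu, inl_mem_disjSum.2 hw⟩
        · obtain ⟨u, hu⟩ := hS0
          exact mem_biUnion.2 ⟨u, hu, by simp [t]⟩
      have h2 := card_le_card this
      rwa [card_disjSum, card_univ, Fintype.card_fin] at h2

/-- Degree sums in vertex sets with a deficient subset. -/
lemma sum_degree_le_of_deficient {X I : Finset ι} {s : ℕ} (hX : ∀ v ∈ X, ∀ w, H.Adj v w → w ∈ X)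
    (hI : I ⊆ X) (hdef : #(I.biUnion fun v => H.neighborFinset v) + (#X - s) < #I) :
    ∃ a b : ℕ, a + #X ≤ b + s ∧ a + b ≤ #X ∧
      ∑ v ∈ X, H.degree v ≤ b * a + a * #X + (#X - b - a) * (#X - b) := by
  let N : Finset ι → Finset ι := fun I => I.biUnion fun v => H.neighborFinset v
  have hN : ∀ {I w}, w ∈ N I ↔ ∃ v ∈ I, H.Adj v w := by simp [N]
  let J := I \ N I
  have hNJ : N J ⊆ N I \ I := by
    intro w hw
    obtain ⟨v, hv, hvw⟩ := hN.1 hw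
    obtain ⟨hvI, hvN⟩ := mem_sdiff.1 hv
    exact mem_sdiff.2 ⟨hN.2 ⟨v, hvI, hvw⟩, fun h => hvN (hN.2 ⟨w, h, hvw.symm⟩)⟩
  have hJX : J ⊆ X := sdiff_subset.trans hI
  have hNX : N J ⊆ X := by
    intro w hw
    obtain ⟨v, hv, hvw⟩ := hN.1 hw
    exact hX v (hJX hv) w hvw
  have hdisj : Disjoint J (N J) := by
    rw [disjoint_left]
    exact fun v hv h => (mem_sdiff.1 (hNJ h)).2 (mem_sdiff.1 hv).1
  have hle : ∀ v ∈ X, H.degree v ≤ #X := by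
    intro v hv
    rw [← SimpleGraph.card_neighborFinset_eq_degree]
    exact card_le_card fun w hw => hX v hv w (by simpa using hw)
  have hleJ : ∀ v ∈ J, H.degree v ≤ #(N J) := by
    intro v hv
    rw [← SimpleGraph.card_neighborFinset_eq_degree]
    exact card_le_card fun w hw => hN.2 ⟨v, hv, by simpa using hw⟩
  have hleC : ∀ v ∈ (X \ J) \ N J, H.degree v ≤ #X - #J := by
    intro v hv
    simp only [mem_sdiff] at hv
    rw [← SimpleGraph.card_neighborFinset_eq_degree, ← card_sdiff_of_subset hJX]
    refine card_le_card fun w hw => ?_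
    rw [SimpleGraph.mem_neighborFinset] at hw
    exact mem_sdiff.2 ⟨hX v hv.1.1 w hw, fun h => hv.2 (hN.2 ⟨w, h, hw.symm⟩)⟩
  have hNJ' : N J ⊆ X \ J := fun w hw => mem_sdiff.2 ⟨hNX hw, disjoint_right.1 hdisj hw⟩
  refine ⟨#(N J), #J, ?_, ?_, ?_⟩
  · have h1 := card_le_card hNJ
    have h2 := card_sdiff_add_card_inter I (N I)
    have h3 := card_sdiff_add_card_inter (N I) I
    rw [inter_comm] at h3
    change #J + _ = _ at h2
    change #(N I) + _ < _ at hdef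
    lia
  · rw [add_comm, ← card_union_of_disjoint hdisj]
    exact card_le_card (union_subset hJX hNX)
  · rw [← sum_sdiff hJX, ← sum_sdiff hNJ']
    have h1 := sum_le_card_nsmul _ _ _ hleJ
    have h2 := sum_le_card_nsmul _ _ _ fun v hv => hle v (hNX hv)
    have h3 := sum_le_card_nsmul _ _ _ hleC
    rw [card_sdiff_of_subset hNJ', card_sdiff_of_subset hJX] at h3
    simp only [smul_eq_mul] at h1 h2 h3
    lia

lemma deficient_bound {x s a b : ℝ} (ha : 0 ≤ a) (h1 : a + x ≤ b + s) (h2 : a + b ≤ x) :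
    b * a + a * x + (x - b - a) * (x - b) ≤ max (s ^ 2) (s * x - s ^ 2 / 4) := by
  have has : 2 * a ≤ s := by linarith
  have h3 : (x - a - b) ^ 2 ≤ (s - 2 * a) ^ 2 := by
    apply pow_le_pow_left₀ <;> linarith
  have h4 : b * a + a * x + (x - b - a) * (x - b) ≤ s ^ 2 + a * (2 * x + 3 * a - 4 * s) := by
    nlinarith
  refine h4.trans ?_
  rcases le_total (2 * x + 3 * a - 4 * s) 0 with h | h
  · exact le_max_of_le_left (by nlinarith)
  · exact le_max_of_le_right (by nlinarith)

lemma exists_component_sum_degree_ge [Nonempty ι] {d : ℝ}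
    (h : d * Fintype.card ι ≤ ∑ v, (H.degree v : ℝ)) :
    ∃ (x₀ : ι) (X : Finset ι), (∀ v, v ∈ X ↔ H.Reachable x₀ v) ∧
      d * #X ≤ ∑ v ∈ X, (H.degree v : ℝ) := by
  classical
  have : Nonempty H.ConnectedComponent := ⟨H.connectedComponentMk (Classical.arbitrary ι)⟩
  have h1 : ∑ C : H.ConnectedComponent, d * #{v | H.connectedComponentMk v = C} ≤
      ∑ C : H.ConnectedComponent, ∑ v with H.connectedComponentMk v = C, (H.degree v : ℝ) := by
    rw [← mul_sum, ← Nat.cast_sum, ← card_eq_sum_card_fiberwise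
      (f := H.connectedComponentMk) (t := univ) (fun _ _ => by simp), card_univ]
    refine h.trans (le_of_eq ?_)
    convert (sum_fiberwise univ H.connectedComponentMk fun v => (H.degree v : ℝ)).symm
  obtain ⟨C, -, hC⟩ := exists_le_of_sum_le univ_nonempty h1
  induction C using SimpleGraph.ConnectedComponent.ind with
  | h x₀ =>
    refine ⟨x₀, _, fun v => ?_, hC⟩
    rw [mem_filter, SimpleGraph.ConnectedComponent.eq, H.reachable_comm]
    simp

/-- A graph with edge density close to `1 / 2` has a nonbipartite component with a large injective
map along edges, or is nearly bipartite, or is nearly balanced and disconnected. -/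
theorem cluster_trichotomy (ht : 10 ^ 8 ≤ Fintype.card ι)
    (hσ : (1 / 2 - 1 / 10 ^ 8) * (Fintype.card ι : ℝ) ^ 2 ≤ ∑ v, (H.degree v : ℝ)) :
    (∃ (x₀ : ι) (S : Finset ι) (f : ι → ι) (q : H.Walk x₀ x₀), (∀ v ∈ S, H.Reachable x₀ v) ∧
      Set.InjOn f S ∧ (∀ v ∈ S, H.Adj v (f v)) ∧ Odd q.length ∧
      q.length ≤ 2 * Fintype.card ι + 1 ∧ (1 / 2 + 1 / 10 ^ 4) * (Fintype.card ι : ℝ) ≤ #S) ∨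
    (∃ A : Finset ι, (#{p : ι × ι | H.Adj p.1 p.2 ∧ (p.1 ∈ A ↔ p.2 ∈ A)} : ℝ) ≤
      4 / 10 ^ 16 * (Fintype.card ι : ℝ) ^ 2) ∨
    ∃ X : Finset ι, (1 / 2 - 3 / 10 ^ 4) * (Fintype.card ι : ℝ) ≤ #X ∧
      (#X : ℝ) ≤ (1 / 2 + 3 / 10 ^ 4) * (Fintype.card ι : ℝ) ∧ ∀ i ∈ X, ∀ j, H.Adj i j → j ∈ X := by
  have : Nonempty ι := Fintype.card_pos_iff.1 (by lia)
  obtain ⟨x₀, X, hX, hdeg⟩ := exists_component_sum_degree_ge (H := H)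
    (d := (1 / 2 - 1 / 10 ^ 8) * (Fintype.card ι : ℝ)) (by linarith)
  have hcl : ∀ v ∈ X, ∀ w, H.Adj v w → w ∈ X := by
    intro v hv w hvw
    rw [hX] at hv ⊢
    exact hv.trans hvw.reachable
  have hX0 : 0 < #X := card_pos.2 ⟨x₀, (hX _).2 (SimpleGraph.Reachable.refl _)⟩
  have hXt : #X ≤ Fintype.card ι := card_le_univ X
  set t := Fintype.card ι
  have htR : (10 : ℝ) ^ 8 ≤ t := by exact_mod_cast ht
  have hXtR : (#X : ℝ) ≤ t := by exact_mod_cast hXt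
  have hX0R : (0 : ℝ) < #X := by exact_mod_cast hX0
  have hlow : (1 / 2 - 1 / 10 ^ 8) * (t : ℝ) ≤ #X := by
    have h1 : ∑ v ∈ X, (H.degree v : ℝ) ≤ #X * #X := by
      rw [← nsmul_eq_mul]
      refine sum_le_card_nsmul _ _ _ fun v hv => ?_
      rw [← SimpleGraph.card_neighborFinset_eq_degree]
      exact_mod_cast card_le_card fun w hw => hcl v hv w (by simpa using hw)
    exact le_of_mul_le_mul_right (hdeg.trans h1) hX0R
  by_cases hup : (#X : ℝ) ≤ (1 / 2 + 3 / 10 ^ 4) * t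
  · exact Or.inr (Or.inr ⟨X, by nlinarith, hup, hcl⟩)
  push Not at hup
  obtain ⟨s, hs1, hs2⟩ : ∃ s : ℕ, (1 / 2 + 1 / 10 ^ 4) * (t : ℝ) ≤ s ∧
      (s : ℝ) ≤ (1 / 2 + 1 / 10 ^ 4) * t + 1 :=
    ⟨⌈(1 / 2 + 1 / 10 ^ 4) * (t : ℝ)⌉₊, Nat.le_ceil _, (Nat.ceil_lt_add_one (by positivity)).le⟩
  have hsX : s ≤ #X := by
    have : (s : ℝ) ≤ #X := by linarith
    exact_mod_cast this
  rcases exists_injOn_adj_or_deficient (H := H) hsX with ⟨S, hSX, hsS, f, hf, hfadj⟩ | ⟨I, hI, hdef⟩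
  · have hsSR : (s : ℝ) ≤ #S := by exact_mod_cast hsS
    by_cases hpar : ∃ v ∈ X, ∃ w, H.Adj v w ∧ H.dist x₀ v % 2 = H.dist x₀ w % 2
    · left
      obtain ⟨v, hv, w, hvw, hd⟩ := hpar
      have hw := hcl v hv w hvw
      rw [hX] at hv hw
      obtain ⟨p, hp, hpl⟩ := hv.exists_path_of_dist
      obtain ⟨p', hp', hpl'⟩ := hw.exists_path_of_dist
      have h1 : p.length < t := hp.length_lt
      have h2 : p'.length < t := hp'.length_lt
      refine ⟨x₀, S, f, p.append (.cons hvw p'.reverse), fun v hv => (hX v).1 (hSX hv), hf, hfadj,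
        ?_, ?_, hs1.trans hsSR⟩
      · simp only [SimpleGraph.Walk.length_append, SimpleGraph.Walk.length_cons,
          SimpleGraph.Walk.length_reverse]
        rw [Nat.odd_iff]
        lia
      · simp only [SimpleGraph.Walk.length_append, SimpleGraph.Walk.length_cons,
          SimpleGraph.Walk.length_reverse]
        lia
    · right; left
      push Not at hpar
      have hEO : #{v ∈ X | H.dist x₀ v % 2 = 0} + #{v ∈ X | ¬ H.dist x₀ v % 2 = 0} = #X :=
        card_filter_add_card_filter_not _
      have hsum : ∑ v ∈ X, (H.degree v : ℝ) ≤ 2 * (#{v ∈ X | H.dist x₀ v % 2 = 0} *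
          #{v ∈ X | ¬ H.dist x₀ v % 2 = 0}) := by
        rw [← sum_filter_add_sum_filter_not X fun v => H.dist x₀ v % 2 = 0]
        have h1 : ∑ v ∈ X with H.dist x₀ v % 2 = 0, (H.degree v : ℝ) ≤
            #{v ∈ X | H.dist x₀ v % 2 = 0} * #{v ∈ X | ¬ H.dist x₀ v % 2 = 0} := by
          rw [← nsmul_eq_mul]
          refine sum_le_card_nsmul _ _ _ fun v hv => ?_
          rw [mem_filter] at hv
          rw [← SimpleGraph.card_neighborFinset_eq_degree]
          refine Nat.cast_le.2 (card_le_card fun w hw => ?_)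
          rw [SimpleGraph.mem_neighborFinset] at hw
          have := hpar v hv.1 w hw
          exact mem_filter.2 ⟨hcl v hv.1 w hw, by lia⟩
        have h2 : ∑ v ∈ X with ¬ H.dist x₀ v % 2 = 0, (H.degree v : ℝ) ≤
            #{v ∈ X | ¬ H.dist x₀ v % 2 = 0} * #{v ∈ X | H.dist x₀ v % 2 = 0} := by
          rw [← nsmul_eq_mul]
          refine sum_le_card_nsmul _ _ _ fun v hv => ?_
          rw [mem_filter] at hv
          rw [← SimpleGraph.card_neighborFinset_eq_degree]
          refine Nat.cast_le.2 (card_le_card fun w hw => ?_)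
          rw [SimpleGraph.mem_neighborFinset] at hw
          have := hpar v hv.1 w hw
          exact mem_filter.2 ⟨hcl v hv.1 w hw, by lia⟩
        linarith
      have hEOR : (#{v ∈ X | H.dist x₀ v % 2 = 0} : ℝ) + #{v ∈ X | ¬ H.dist x₀ v % 2 = 0} = #X := by
        exact_mod_cast hEO
      have hbig : (1 - 2 / 10 ^ 8) * (t : ℝ) ≤ #X := by
        have h1 : (1 / 2 - 1 / 10 ^ 8) * (t : ℝ) * #X ≤ (#X / 2) * #X := by
          refine (hdeg.trans hsum).trans ?_
          rw [← hEOR]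
          nlinarith [sq_nonneg ((#{v ∈ X | H.dist x₀ v % 2 = 0} : ℝ) -
            #{v ∈ X | ¬ H.dist x₀ v % 2 = 0})]
        have := le_of_mul_le_mul_right h1 hX0R
        linarith
      refine ⟨univ.filter fun v => v ∈ X → H.dist x₀ v % 2 = 0, ?_⟩
      have hsub : ({p : ι × ι | H.Adj p.1 p.2 ∧
          (p.1 ∈ ({v | v ∈ X → H.dist x₀ v % 2 = 0} : Finset ι) ↔
            p.2 ∈ ({v | v ∈ X → H.dist x₀ v % 2 = 0} : Finset ι))} : Finset (ι × ι)) ⊆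
          Xᶜ ×ˢ Xᶜ := by
        rintro ⟨v, w⟩
        simp only [mem_filter, mem_univ, true_and, mem_product, mem_compl]
        rintro ⟨hvw, hiff⟩
        have hiffX : v ∈ X ↔ w ∈ X := ⟨fun h => hcl v h w hvw, fun h => hcl w h v hvw.symm⟩
        rw [← hiffX, and_self]
        intro hv
        have := hpar v hv w hvw
        simp only [← hiffX, hv, true_imp_iff] at hiff
        lia
      have h3 := card_le_card hsub
      rw [card_product, card_compl] at h3
      have h4 : ((Fintype.card ι - #X : ℕ) : ℝ) ≤ 2 / 10 ^ 8 * t := by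
        rw [Nat.cast_sub hXt]
        linarith
      refine (Nat.cast_le.2 h3).trans ?_
      rw [Nat.cast_mul]
      calc _ ≤ (2 / 10 ^ 8 * (t : ℝ)) * (2 / 10 ^ 8 * t) := by gcongr
        _ = _ := by ring
  · exfalso
    obtain ⟨a, b, hab, hab', hsum⟩ := sum_degree_le_of_deficient hcl hI hdef
    have habR : (a : ℝ) + #X ≤ b + s := by exact_mod_cast hab
    have habR' : (a : ℝ) + b ≤ #X := by exact_mod_cast hab'
    have hsumR : ∑ v ∈ X, (H.degree v : ℝ) ≤
        b * a + a * #X + (#X - b - a : ℝ) * (#X - b : ℝ) := by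
      have h1 : ((#X - b - a : ℕ) : ℝ) = #X - b - a := by
        rw [Nat.cast_sub (by lia), Nat.cast_sub (by lia)]
      have h2 : ((#X - b : ℕ) : ℝ) = #X - b := by rw [Nat.cast_sub (by lia)]
      rw [← h1, ← h2]
      exact_mod_cast hsum
    have hmax := (hdeg.trans hsumR).trans (deficient_bound (Nat.cast_nonneg a) habR habR')
    have hs3 : (s : ℝ) ≤ (1 / 2 + 11 / 10 ^ 5) * t := by linarith
    have hs0 : (0 : ℝ) ≤ s := Nat.cast_nonneg s
    rcases le_max_iff.1 hmax with h | h
    · have h1 : (s : ℝ) ^ 2 ≤ ((1 / 2 + 11 / 10 ^ 5) * t) ^ 2 := by gcongr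
      nlinarith
    · have h1 : ((1 / 2 : ℝ) * t) ^ 2 ≤ (s : ℝ) ^ 2 := by
        apply pow_le_pow_left₀ <;> linarith
      have h2 : (s : ℝ) * #X ≤ (1 / 2 + 11 / 10 ^ 5) * t * #X := by gcongr
      have h3 : (t : ℝ) * #X ≤ t * t := by gcongr
      nlinarith

end ClusterStability

section Regularity

open Finset

variable {V : Type*} {G : SimpleGraph V} [DecidableRel G.Adj]

/-- Most vertices of one side of a regular pair have many neighbours in a given large subset of the
other side. -/
lemma SimpleGraph.IsUniform.card_filter_lt {ε θ : ℝ} {U W X : Finset V} {b : ℕ}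
    (h : G.IsUniform ε U W) (hθ : θ ≤ G.edgeDensity U W) (hU : U.Nonempty) (hW : W.Nonempty)
    (hX : X ⊆ W) (hXc : #W * ε ≤ #X) (hb : b ≤ (θ - ε) * #X) :
    (#{v ∈ U | #{w ∈ X | G.Adj v w} < b} : ℝ) < #U * ε := by
  by_contra! hcon
  set B : Finset V := {v ∈ U | #{w ∈ X | G.Adj v w} < b} with hB
  have hε := h.pos
  have hU0 : (0 : ℝ) < #U := by exact_mod_cast hU.card_pos
  have hW0 : (0 : ℝ) < #W := by exact_mod_cast hW.card_pos
  have hB0 : (0 : ℝ) < #B := (mul_pos hU0 hε).trans_le hcon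
  have hX0 : (0 : ℝ) < #X := (mul_pos hW0 hε).trans_le hXc
  have h1 := h (filter_subset _ _) hX hcon hXc
  rw [← hB, abs_lt] at h1
  have h2 : θ - ε < (G.edgeDensity B X : ℝ) := by linarith
  rw [SimpleGraph.edgeDensity_def] at h2
  push_cast at h2
  rw [lt_div_iff₀ (by positivity)] at h2
  have h3 : #(G.interedges B X) ≤ #B * b := by
    rw [SimpleGraph.interedges_def, card_filter, sum_product, ← smul_eq_mul]
    refine sum_le_card_nsmul _ _ _ fun v hv => ?_
    rw [← card_filter]
    exact (mem_filter.1 hv).2.le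
  have h4 : (#(G.interedges B X) : ℝ) ≤ #B * b := by exact_mod_cast h3
  nlinarith

variable [Fintype V]

lemma sum_degree_eq_card_adj : ∑ v, G.degree v = #{p : V × V | G.Adj p.1 p.2} := by
  rw [card_filter, ← univ_product_univ, sum_product]
  refine sum_congr rfl fun v _ => ?_
  rw [← SimpleGraph.card_neighborFinset_eq_degree, SimpleGraph.neighborFinset_eq_filter,
    card_filter]

variable [DecidableEq V]

/-- The cluster graph of a partition: two parts are adjacent if they form a regular pair which is
not too sparse. -/
def clusterGraph (G : SimpleGraph V) [DecidableRel G.Adj] (P : Finpartition (univ : Finset V))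
    (ε θ : ℝ) : SimpleGraph P.parts where
  Adj U W := U ≠ W ∧ G.IsUniform ε U.1 W.1 ∧ θ ≤ G.edgeDensity U.1 W.1
  symm := ⟨fun U W h => ⟨h.1.symm, h.2.1.symm, by rw [SimpleGraph.edgeDensity_comm]; exact h.2.2⟩⟩
  loopless := ⟨fun _ h => h.1 rfl⟩

/-- The part of a partition containing a given point. -/
def partOf (P : Finpartition (univ : Finset V)) (v : V) : P.parts :=
  ⟨P.part v, P.part_mem.2 (mem_univ v)⟩

lemma partOf_eq_iff {P : Finpartition (univ : Finset V)} {v : V} {U : P.parts} :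
    partOf P v = U ↔ v ∈ U.1 := by
  rw [partOf, Subtype.ext_iff]
  exact P.part_eq_iff_mem U.2

lemma card_adj_not_clusterGraph_le [Nonempty V] {P : Finpartition (univ : Finset V)} {ε θ : ℝ}
    (hP : P.IsEquipartition) (hPu : P.IsUniform G ε) (hε : 0 < ε) (hθ : 0 ≤ θ)
    (hl : 4 / ε ≤ #P.parts) [DecidableRel (clusterGraph G P ε θ).Adj] :
    (#{p : V × V | G.Adj p.1 p.2 ∧ ¬ (clusterGraph G P ε θ).Adj (partOf P p.1) (partOf P p.2)} : ℝ)
      ≤ (4 * ε + ε / 2 + 4 * θ) * (Fintype.card V : ℝ) ^ 2 := by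
  have h1 := hP.sum_nonUniforms_lt univ_nonempty hε hPu
  have h2 := hP.card_biUnion_offDiag_le hε hl
  have h3 := hP.card_interedges_sparsePairs_le (G := G) hθ
  rw [card_univ] at h1 h2 h3
  have hsub : ({p : V × V | G.Adj p.1 p.2 ∧
      ¬ (clusterGraph G P ε θ).Adj (partOf P p.1) (partOf P p.2)} : Finset (V × V)) ⊆
      ((P.nonUniforms G ε).biUnion (fun (U, W) ↦ U ×ˢ W) ∪ P.parts.biUnion offDiag) ∪
        (P.sparsePairs G θ).biUnion fun (U, W) ↦ G.interedges U W := by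
    rintro ⟨x, y⟩ hxy
    obtain ⟨-, hadj, hcl⟩ := mem_filter.1 hxy
    have hx := partOf_eq_iff.1 (rfl : partOf P x = _)
    have hy := partOf_eq_iff.1 (rfl : partOf P y = _)
    simp only at hadj hcl
    generalize partOf P x = U at hcl hx
    generalize partOf P y = W at hcl hy
    obtain ⟨U, hU⟩ := U
    obtain ⟨W, hW⟩ := W
    simp only [clusterGraph, ne_eq, Subtype.mk.injEq, not_and] at hcl
    simp only [mem_biUnion, mem_union, mem_product, Prod.exists, mem_offDiag,
      P.mk_mem_nonUniforms, Finpartition.mk_mem_sparsePairs, SimpleGraph.mem_interedges_iff]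
    obtain rfl | hUW := eq_or_ne U W
    · exact Or.inl (Or.inr ⟨U, hU, hx, hy, hadj.ne⟩)
    by_cases hu : G.IsUniform ε U W
    · exact Or.inr ⟨U, W, ⟨hU, hW, hUW, not_le.1 (hcl hUW hu)⟩, hx, hy, hadj⟩
    · exact Or.inl (Or.inl ⟨U, W, ⟨hU, hW, hUW, hu⟩, hx, hy⟩)
  have h4 := (card_le_card hsub).trans ((card_union_le _ _).trans
    (Nat.add_le_add_right (card_union_le _ _) _))
  have h5 := (Nat.cast_le (α := ℝ)).2 h4
  push_cast at h5
  linarith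

/-- Pairs of vertices lying in a given set of pairs of parts. -/
lemma card_filter_partOf_le {P : Finpartition (univ : Finset V)} {M : ℕ}
    (hM : ∀ U ∈ P.parts, #U ≤ M) (R : Finset (P.parts × P.parts)) :
    #{p : V × V | (partOf P p.1, partOf P p.2) ∈ R} ≤ #R * (M * M) := by
  rw [← smul_eq_mul]
  refine (card_le_card (t := R.biUnion fun q => q.1.1 ×ˢ q.2.1) ?_).trans
    (card_biUnion_le.trans (sum_le_card_nsmul _ _ _ fun q _ => ?_))
  · intro p hp
    exact mem_biUnion.2 ⟨_, (mem_filter.1 hp).2, mem_product.2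
      ⟨partOf_eq_iff.1 rfl, partOf_eq_iff.1 rfl⟩⟩
  · rw [card_product]
    exact Nat.mul_le_mul (hM _ q.1.2) (hM _ q.2.2)

lemma card_filter_partOf_mem_ge {P : Finpartition (univ : Finset V)} {M : ℕ}
    (hM : ∀ U ∈ P.parts, M ≤ #U) (A : Finset P.parts) :
    #A * M ≤ #{v : V | partOf P v ∈ A} := by
  rw [card_eq_sum_card_fiberwise (f := partOf P) (t := A) (fun v hv => (by simpa using hv)),
    ← smul_eq_mul]
  refine card_nsmul_le_sum _ _ _ fun U hU => (hM _ U.2).trans (card_le_card fun v hv => ?_)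
  rw [mem_filter, mem_filter]
  have := partOf_eq_iff.2 hv
  exact ⟨⟨mem_univ _, this ▸ hU⟩, this⟩

end Regularity

section Cases

open Finset

variable {V : Type*} [Fintype V] [DecidableEq V] {G : SimpleGraph V} [DecidableRel G.Adj]

lemma exists_many_isCyc_of_few_nonadj {P : Finset V} {k : ℕ} (hk : Odd k) (hk' : 10 ^ 10 ≤ k)
    (hV : Fintype.card V = 2 * k - 1)
    (h1 : (1 / 2 - 4 / 10 ^ 4) * (Fintype.card V : ℝ) ≤ #P)
    (h2 : (#P : ℝ) ≤ (1 / 2 + 4 / 10 ^ 4) * (Fintype.card V : ℝ))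
    (hmiss : (∑ x ∈ P, #{y ∈ Pᶜ | ¬ G.Adj x y} : ℕ) ≤ 1 / 10 ^ 8 * (Fintype.card V : ℝ) ^ 2) :
    ∃ F : Finset (List V), (k / 1000) ^ (k - 1) ≤ 2 ^ k * #F ∧
      ((∀ l ∈ F, l.length = k ∧ IsCyc G l) ∨ ∀ l ∈ F, l.length = k ∧ IsCyc Gᶜ l) := by
  have hn : (Fintype.card V : ℝ) = 2 * k - 1 := by rw [hV, Nat.cast_sub (by lia)]; push_cast; ring
  have hkR : (10 : ℝ) ^ 10 ≤ k := by exact_mod_cast hk'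
  have hs : (k : ℝ) / 1000 - 1 ≤ (k / 1000 : ℕ) := by
    have : (k : ℝ) ≤ 1000 * (k / 1000 : ℕ) + 1000 := by
      exact_mod_cast (by lia : k ≤ 1000 * (k / 1000) + 1000)
    linarith
  have hPc : (#P : ℝ) + #Pᶜ = Fintype.card V := by exact_mod_cast card_add_card_compl P
  rw [hn] at h1 h2 hmiss hPc
  have hP1 : (k : ℝ) ≤ #P + (k / 1000 : ℕ) := by linarith
  have hP2 : (k : ℝ) ≤ #Pᶜ + (k / 1000 : ℕ) := by linarith
  refine exists_many_isCyc_of_extremal (by lia) hk (by lia) hV disjoint_compl_right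
    (union_compl P) (by exact_mod_cast hP1) (by exact_mod_cast hP2) ?_
  have h3 : ((∑ x ∈ P, #{y ∈ Pᶜ | ¬ G.Adj x y} : ℕ) : ℝ) ≤ (k / 1000 : ℕ) ^ 2 := by
    have h4 : ((k : ℝ) / 2000) ^ 2 ≤ ((k / 1000 : ℕ) : ℝ) ^ 2 := by
      apply pow_le_pow_left₀ (by positivity)
      linarith
    nlinarith
  exact_mod_cast h3

lemma exists_many_isCyc_of_near_disconnected {P : Finset V} {k : ℕ} (hk : Odd k)
    (hk' : 10 ^ 10 ≤ k) (hV : Fintype.card V = 2 * k - 1)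
    (h1 : (1 / 2 - 4 / 10 ^ 4) * (Fintype.card V : ℝ) ≤ #P)
    (h2 : (#P : ℝ) ≤ (1 / 2 + 4 / 10 ^ 4) * (Fintype.card V : ℝ))
    (hmiss : (∑ x ∈ P, #{y ∈ Pᶜ | G.Adj x y} : ℕ) ≤ 1 / 10 ^ 8 * (Fintype.card V : ℝ) ^ 2) :
    ∃ F : Finset (List V), (k / 1000) ^ (k - 1) ≤ 2 ^ k * #F ∧
      ((∀ l ∈ F, l.length = k ∧ IsCyc G l) ∨ ∀ l ∈ F, l.length = k ∧ IsCyc Gᶜ l) := by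
  have h := exists_many_isCyc_of_few_nonadj (G := Gᶜ) hk hk' hV h1 h2 (by
    refine le_trans (le_of_eq ?_) hmiss
    refine congrArg _ (sum_congr rfl fun x hx => congrArg card ?_)
    ext y
    simp only [mem_filter, SimpleGraph.compl_adj, mem_compl]
    have : y ∉ P → x ≠ y := fun hy h => hy (h ▸ hx)
    tauto)
  obtain ⟨F, hF, hF'⟩ := h
  rw [compl_compl] at hF'
  exact ⟨F, hF, hF'.symm⟩

lemma card_adj_eq (P : Finset V) : #{p : V × V | G.Adj p.1 p.2} =
    #{p : V × V | G.Adj p.1 p.2 ∧ (p.1 ∈ P ↔ p.2 ∈ P)} + 2 * ∑ x ∈ P, #{y ∈ Pᶜ | G.Adj x y} := by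
  have h0 : ∑ x ∈ P, #{y ∈ Pᶜ | G.Adj x y} = #{p ∈ P ×ˢ Pᶜ | G.Adj p.1 p.2} := by
    rw [card_filter, sum_product]
    simp only [card_filter]
  have h1 : #{p ∈ Pᶜ ×ˢ P | G.Adj p.1 p.2} = #{p ∈ P ×ˢ Pᶜ | G.Adj p.1 p.2} := by
    refine card_bij (fun p _ => p.swap) ?_ ?_ ?_
    · rintro ⟨x, y⟩
      simp only [mem_filter, mem_product, Prod.swap]
      exact fun h => ⟨⟨h.1.2, h.1.1⟩, h.2.symm⟩
    · exact fun p _ q _ h => Prod.swap_injective h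
    · rintro ⟨x, y⟩
      simp only [mem_filter, mem_product]
      exact fun h => ⟨(y, x), ⟨⟨h.1.2, h.1.1⟩, h.2.symm⟩, rfl⟩
  have hd : Disjoint {p ∈ P ×ˢ Pᶜ | G.Adj p.1 p.2} {p ∈ Pᶜ ×ˢ P | G.Adj p.1 p.2} := by
    rw [disjoint_left]
    rintro ⟨x, y⟩
    simp only [mem_filter, mem_product, mem_compl]
    tauto
  rw [h0, two_mul]
  nth_rewrite 2 [← h1]
  rw [← card_union_of_disjoint hd, ← card_union_of_disjoint]
  · congr 1
    ext ⟨x, y⟩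
    simp only [mem_filter, mem_product, mem_compl, mem_univ, true_and, mem_union]
    tauto
  · rw [disjoint_left]
    rintro ⟨x, y⟩
    simp only [mem_filter, mem_product, mem_compl, mem_union]
    tauto

lemma exists_many_isCyc_of_near_bipartite_of_card_adj {P : Finset V} {k : ℕ} (hk : Odd k)
    (hk' : 10 ^ 10 ≤ k) (hV : Fintype.card V = 2 * k - 1)
    (hadj : (Fintype.card V : ℝ) * (Fintype.card V - 1) / 2 ≤ #{p : V × V | G.Adj p.1 p.2})
    (hin : (#{p : V × V | G.Adj p.1 p.2 ∧ (p.1 ∈ P ↔ p.2 ∈ P)} : ℝ) ≤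
      1 / 10 ^ 8 * (Fintype.card V : ℝ) ^ 2) :
    ∃ F : Finset (List V), (k / 1000) ^ (k - 1) ≤ 2 ^ k * #F ∧
      ((∀ l ∈ F, l.length = k ∧ IsCyc G l) ∨ ∀ l ∈ F, l.length = k ∧ IsCyc Gᶜ l) := by
  have hn : (Fintype.card V : ℝ) = 2 * k - 1 := by rw [hV, Nat.cast_sub (by lia)]; push_cast; ring
  have hkR : (10 : ℝ) ^ 10 ≤ k := by exact_mod_cast hk'
  have hPc : (#P : ℝ) + #Pᶜ = Fintype.card V := by exact_mod_cast card_add_card_compl P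
  have hsplit : (∑ x ∈ P, #{y ∈ Pᶜ | G.Adj x y}) + ∑ x ∈ P, #{y ∈ Pᶜ | ¬ G.Adj x y} =
      #P * #Pᶜ := by
    rw [← sum_add_distrib, ← smul_eq_mul, ← sum_const]
    exact sum_congr rfl fun x _ => card_filter_add_card_filter_not _
  have hsplitR : ((∑ x ∈ P, #{y ∈ Pᶜ | G.Adj x y} : ℕ) : ℝ) +
      (∑ x ∈ P, #{y ∈ Pᶜ | ¬ G.Adj x y} : ℕ) = #P * #Pᶜ := by exact_mod_cast hsplit
  have htot := card_adj_eq (G := G) P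
  have htotR : (#{p : V × V | G.Adj p.1 p.2} : ℝ) =
      #{p : V × V | G.Adj p.1 p.2 ∧ (p.1 ∈ P ↔ p.2 ∈ P)} +
        2 * (∑ x ∈ P, #{y ∈ Pᶜ | G.Adj x y} : ℕ) := by exact_mod_cast htot
  set N : ℝ := (Fintype.card V : ℝ)
  have hN : (10 : ℝ) ^ 10 ≤ N := by rw [hn]; linarith
  have hmiss0 : (0 : ℝ) ≤ (∑ x ∈ P, #{y ∈ Pᶜ | ¬ G.Adj x y} : ℕ) := Nat.cast_nonneg _
  generalize ((∑ x ∈ P, #{y ∈ Pᶜ | G.Adj x y} : ℕ) : ℝ) = e at *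
  have hNN : 10 ^ 10 * N ≤ N ^ 2 := by nlinarith
  have he : (1 / 4 - 1 / 10 ^ 8) * N ^ 2 ≤ e := by nlinarith
  have hq : (#P : ℝ) * #Pᶜ = N ^ 2 / 4 - (#P - N / 2) ^ 2 := by
    rw [← hPc]; ring
  have hsq : (#P - N / 2) ^ 2 ≤ (4 / 10 ^ 4 * N) ^ 2 := by nlinarith
  obtain ⟨h3, h4⟩ := abs_le.1 (abs_le_of_sq_le_sq hsq (by positivity))
  refine exists_many_isCyc_of_few_nonadj (P := P) hk hk' hV ?_ ?_ ?_
  · linarith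
  · linarith
  · nlinarith [sq_nonneg (#P - N / 2)]

end Cases

section Large

open Finset

variable {V : Type*} [Fintype V] [DecidableEq V] {G : SimpleGraph V} [DecidableRel G.Adj]

lemma cluster_capacity_le {k M t s d cap : ℕ} (hs : (1 / 2 + 1 / 10 ^ 4) * (t : ℝ) ≤ s)
    (hcap : M ≤ 2 * cap + 5 * t ^ 2 + 2 * (10 ^ 10 * d) + 2) (htM : 5 * 10 ^ 6 * t ^ 2 ≤ M)
    (hd : 10 ^ 20 * d ≤ M + 10 ^ 20) (hM : 10 ^ 40 ≤ M) (hn : 2 * k - 1 ≤ t * (M + 1)) :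
    k ≤ 2 * (s * cap) := by
  have hn' : 2 * k ≤ t * (M + 1) + 1 := by lia
  rcases Nat.eq_zero_or_pos t with rfl | ht
  · obtain rfl : k = 0 := by lia
    exact Nat.zero_le _
  rify at hcap htM hd hM hn' ⊢
  have ht0 : (0 : ℝ) ≤ t := Nat.cast_nonneg t
  have h3 : (1 - 1 / 10 ^ 5) * (M : ℝ) ≤ 2 * cap := by linarith
  have h4 : ((1 / 2 + 1 / 10 ^ 4) * (t : ℝ)) * ((1 - 1 / 10 ^ 5) * (M : ℝ)) ≤ s * (2 * cap) := by
    apply mul_le_mul hs h3 (by positivity) (by positivity)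
  have h6 : (t : ℝ) * 10 ^ 40 ≤ t * M := by gcongr
  have ht1 : (1 : ℝ) ≤ t := by exact_mod_cast ht
  linarith

lemma exists_many_isCyc_of_cluster_matching {P : Finpartition (univ : Finset V)} {k M t : ℕ}
    (hk : Odd k) (ht : #P.parts = t) (hV : Fintype.card V = 2 * k - 1) (hM1 : ∀ U ∈ P.parts, M ≤ #U)
    (hM2 : ∀ U ∈ P.parts, #U ≤ M + 1) (hM : 10 ^ 40 ≤ M) (ht0 : 1 ≤ t)
    (htM : 5 * 10 ^ 6 * t ^ 2 ≤ M)
    {H : SimpleGraph P.parts} (hH : H = clusterGraph G P (1 / 10 ^ 20) (1 / 10 ^ 9))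
    {x₀ : P.parts} {S : Finset P.parts} {f : P.parts → P.parts} {q : H.Walk x₀ x₀}
    (hS : ∀ v ∈ S, H.Reachable x₀ v) (hf : Set.InjOn f S) (hadj : ∀ v ∈ S, H.Adj v (f v))
    (hq : Odd q.length) (hql : q.length ≤ 2 * t + 1)
    (hSc : (1 / 2 + 1 / 10 ^ 4) * (t : ℝ) ≤ #S) :
    ∃ F : Finset (List V), (M / 10 ^ 20 + 1) ^ (k - 1) ≤ #F ∧
      ∀ l ∈ F, l.length = k ∧ IsCyc G l := by
  have hn1 : t * M ≤ 2 * k - 1 := by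
    rw [← ht, ← hV, ← card_univ, ← P.sum_card_parts, ← smul_eq_mul]
    exact card_nsmul_le_sum _ _ _ hM1
  have hn2 : 2 * k - 1 ≤ t * (M + 1) := by
    rw [← ht, ← hV, ← card_univ, ← P.sum_card_parts, ← smul_eq_mul]
    exact sum_le_card_nsmul _ _ _ hM2
  have hSt : #S ≤ t := by
    have := card_le_univ S
    rwa [Fintype.card_coe, ht] at this
  obtain ⟨d, hd⟩ : ∃ d, M / 10 ^ 20 + 1 = d := ⟨_, rfl⟩
  rw [hd]
  have hd1 : M < 10 ^ 20 * d := by lia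
  have hd2 : 10 ^ 20 * d ≤ M + 10 ^ 20 := by lia
  have htt : t ≤ t ^ 2 := Nat.le_self_pow two_ne_zero t
  have hMn : M ≤ t * M := Nat.le_mul_of_pos_left _ ht0
  have hBle : q.length + #S * (2 * Fintype.card P.parts) ≤ 5 * t ^ 2 := by
    rw [Fintype.card_coe, ht]
    have : #S * (2 * t) ≤ t * (2 * t) := Nat.mul_le_mul_right _ hSt
    have h2 : t * (2 * t) = 2 * t ^ 2 := by ring
    lia
  obtain ⟨cap, hcap1, hcap2⟩ : ∃ cap : ℕ, 2 * cap + 5 * t ^ 2 + 2 * (10 ^ 10 * d) + 1 ≤ M ∧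
      M ≤ 2 * cap + 5 * t ^ 2 + 2 * (10 ^ 10 * d) + 2 :=
    ⟨(M - (5 * t ^ 2 + 2 * (10 ^ 10 * d) + 1)) / 2, by lia, by lia⟩
  have hkcap : k ≤ 2 * (#S * cap) := by
    exact cluster_capacity_le hSc hcap2 htM hd2 hM hn2
  have hMR : (10 : ℝ) ^ 40 ≤ M := by rify at hM; exact hM
  have hdR : (10 : ℝ) ^ 20 * d ≤ M + 10 ^ 20 := by rify at hd2; exact hd2
  have hdR' : (M : ℝ) + 1 ≤ 10 ^ 20 * d := by
    have := Nat.succ_le_of_lt hd1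
    rify at this
    exact this
  clear hd
  obtain ⟨p, hp, hpc⟩ := exists_balanced_walk hS hf hadj hq hk hBle (by lia) hkcap
  have hk3 : 3 ≤ k := by lia
  have hne : ∀ U : P.parts, U.1.Nonempty := fun U => P.nonempty_of_mem_parts U.2
  have hM2R : ∀ U : P.parts, (#U.1 : ℝ) ≤ M + 1 := fun U => by exact_mod_cast hM2 _ U.2
  have hM1R : ∀ U : P.parts, (M : ℝ) ≤ #U.1 := fun U => by exact_mod_cast hM1 _ U.2
  have hsmall : ∀ U : P.parts, (#U.1 : ℝ) * (1 / 10 ^ 20) ≤ d := by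
    intro U
    have := hM2R U
    linarith
  have key : ∀ i j, H.Adj i j → ∀ X ⊆ j.1, ∀ b : ℕ, (d : ℝ) ≤ #X →
      (b : ℝ) ≤ (1 / 10 ^ 9 - 1 / 10 ^ 20) * #X → #{v ∈ i.1 | #{w ∈ X | G.Adj v w} < b} ≤ d := by
    intro i j hij X hX b h1 h2
    subst hH
    have := (hij.2.1.card_filter_lt hij.2.2 (hne i) (hne j) hX ((hsmall j).trans h1) h2).le.trans
      (hsmall i)
    exact_mod_cast this
  obtain ⟨F, hF, hF'⟩ := exists_many_isCyc_of_cluster_walk (G := G) (H := H)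
    (fib := fun U => U.1) (c := fun j => p.getVert (j + 1)) (m := k - 1) (M := M) (D := d)
    (a := 10 ^ 10 * d) (b := 2 * d) (r := d)
    (fun i j hij => P.disjoint i.2 j.2 fun h => hij (Subtype.ext h)) (fun U => hM1 _ U.2)
    (fun i j hij X hX ha => by
      have haR : (10 : ℝ) ^ 10 * d ≤ #X := by rify at ha; exact ha
      refine key i j hij X hX _ ?_ ?_
      · nlinarith [(Nat.cast_nonneg d : (0 : ℝ) ≤ d)]
      · push_cast
        nlinarith [(Nat.cast_nonneg d : (0 : ℝ) ≤ d)])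
    (fun i j hij => by
      have := hM1R j
      refine key i j hij _ Subset.rfl _ ?_ ?_
      · linarith
      · push_cast
        linarith)
    (by lia) (by lia) (by lia) (by lia)
    (fun j hj => p.adj_getVert_succ (by lia))
    (by
      have h1 : p.getVert (k - 1 + 1) = x₀ := by
        rw [show k - 1 + 1 = p.length by lia]; exact p.getVert_length
      have h2 := p.adj_getVert_succ (i := 0) (by lia)
      rw [SimpleGraph.Walk.getVert_zero] at h2
      simpa only [h1] using h2)
    (fun i => by
      have h1 := p.card_filter_getVert_eq i
      rw [hp] at h1
      have h2 := hpc i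
      rw [show k - 1 + 1 = k by lia, h1]
      lia)
  exact ⟨F, hF, fun l hl => ⟨by rw [(hF' l hl).1]; lia, (hF' l hl).2⟩⟩

end Large

section Majority

open Finset

lemma cluster_degree_sum_ge {N M t σ adj : ℝ} (h1 : N * (N - 1) / 2 ≤ adj)
    (h2 : adj ≤ (4 * (1 / 10 ^ 20) + 1 / 10 ^ 20 / 2 + 4 * (1 / 10 ^ 9)) * N ^ 2 +
      σ * ((M + 1) * (M + 1))) (htM : t * M ≤ N) (hM : 10 ^ 40 ≤ M) (hN : 10 ^ 40 ≤ N)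
    (ht : 0 ≤ t) (hσ : 0 ≤ σ) : (1 / 2 - 1 / 10 ^ 8) * t ^ 2 ≤ σ := by
  have hM0 : 0 < M ^ 2 := by positivity
  have h3 : (M + 1) * (M + 1) ≤ (1 + 1 / 10 ^ 10) * M ^ 2 := by nlinarith
  have h4 : σ * ((M + 1) * (M + 1)) ≤ σ * ((1 + 1 / 10 ^ 10) * M ^ 2) := by gcongr
  have h5 : (t * M) ^ 2 ≤ N ^ 2 := by gcongr
  have h6 : 10 ^ 40 * N ≤ N ^ 2 := by nlinarith
  have h7 : (1 / 2 - 5 / 10 ^ 9) * t ^ 2 * M ^ 2 ≤ (1 + 1 / 10 ^ 10) * σ * M ^ 2 := by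
    have : (1 / 2 - 5 / 10 ^ 9) * N ^ 2 ≤ σ * ((1 + 1 / 10 ^ 10) * M ^ 2) := by linarith
    nlinarith
  have h8 := le_of_mul_le_mul_right h7 hM0
  nlinarith [sq_nonneg t]

lemma sum_card_filter_eq_card {V : Type*} [DecidableEq V] {G : SimpleGraph V} [DecidableRel G.Adj]
    (P Q : Finset V) :
    ∑ x ∈ P, #{y ∈ Q | G.Adj x y} = #{p ∈ P ×ˢ Q | G.Adj p.1 p.2} := by
  rw [card_filter, sum_product]
  simp only [card_filter]

/-- In a large graph containing at least half of all edges, either the graph or its complement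
contains many cycles of length `k`. -/
theorem exists_many_isCyc_of_majority : ∃ C K : ℕ, 0 < C ∧ ∀ (V : Type*) [Fintype V] [DecidableEq V]
    (G : SimpleGraph V) [DecidableRel G.Adj] (k : ℕ), Odd k → K ≤ k → Fintype.card V = 2 * k - 1 →
    (Fintype.card V : ℝ) * (Fintype.card V - 1) / 2 ≤ #{p : V × V | G.Adj p.1 p.2} →
    ∃ (F : Finset (List V)) (d : ℕ), k ≤ C * d ∧ d ^ (k - 1) ≤ 2 ^ k * #F ∧
      ((∀ l ∈ F, l.length = k ∧ IsCyc G l) ∨ ∀ l ∈ F, l.length = k ∧ IsCyc Gᶜ l) := by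
  obtain ⟨l, hl⟩ : ∃ l : ℕ, l = 10 ^ 21 := ⟨_, rfl⟩
  obtain ⟨T, hT1, hT⟩ : ∃ T : ℕ, 1 ≤ T ∧ SzemerediRegularity.bound (1 / 10 ^ 20 : ℝ) l ≤ T :=
    ⟨_, le_max_left 1 _, le_max_right _ _⟩
  refine ⟨10 ^ 20 * T, 10 ^ 60 * T ^ 3, by positivity, ?_⟩
  intro V _ _ G _ k hk hKk hV hadj
  classical
  have hT3 : T ≤ T ^ 3 := Nat.le_self_pow three_ne_zero T
  have hlV : l ≤ Fintype.card V := by lia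
  have : Nonempty V := Fintype.card_pos_iff.1 (by lia)
  obtain ⟨P, hP, hlP, hPT, hPu⟩ := szemeredi_regularity G (ε := (1 / 10 ^ 20 : ℝ)) (by positivity) hlV
  obtain ⟨t, ht⟩ : ∃ t, #P.parts = t := ⟨_, rfl⟩
  have hPT' : #P.parts ≤ T := hPT.trans hT
  rw [ht] at hlP hPT'
  have ht0 : 1 ≤ t := by lia
  obtain ⟨M, hM⟩ : ∃ M, Fintype.card V / t = M := ⟨_, rfl⟩
  have hM1 : ∀ U ∈ P.parts, M ≤ #U := by
    intro U hU
    have := hP.average_le_card_part hU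
    rwa [card_univ, ht, hM] at this
  have hM2 : ∀ U ∈ P.parts, #U ≤ M + 1 := by
    intro U hU
    have := hP.card_part_le_average_add_one hU
    rwa [card_univ, ht, hM] at this
  have hn1 : t * M ≤ Fintype.card V := by
    rw [← ht, ← card_univ, ← P.sum_card_parts, ← smul_eq_mul]
    exact card_nsmul_le_sum _ _ _ hM1
  have hn2 : Fintype.card V ≤ t * (M + 1) := by
    rw [← ht, ← card_univ, ← P.sum_card_parts, ← smul_eq_mul]
    exact sum_le_card_nsmul _ _ _ hM2
  clear hM
  have hMT : 10 ^ 60 * T ^ 2 ≤ M + 1 := by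
    have h1 : T * (10 ^ 60 * T ^ 2) ≤ T * (M + 1) := by
      have h2 : t * (M + 1) ≤ T * (M + 1) := Nat.mul_le_mul_right _ hPT'
      have h3 : T * (10 ^ 60 * T ^ 2) = 10 ^ 60 * T ^ 3 := by ring
      lia
    exact Nat.le_of_mul_le_mul_left h1 hT1
  have hT2 : T ≤ T ^ 2 := Nat.le_self_pow two_ne_zero T
  have htT2 : t ^ 2 ≤ T ^ 2 := Nat.pow_le_pow_left hPT' 2
  have hM40 : 10 ^ 40 ≤ M := by lia
  have hk10 : 10 ^ 10 ≤ k := by lia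
  have hk40 : 10 ^ 40 ≤ Fintype.card V := by lia
  have hMR : (10 : ℝ) ^ 40 ≤ M := by rify at hM40; exact hM40
  have hNR : (10 : ℝ) ^ 40 ≤ Fintype.card V := by rify at hk40; exact hk40
  have hn1R : (t : ℝ) * M ≤ Fintype.card V := by exact_mod_cast hn1
  have hn2R : (Fintype.card V : ℝ) ≤ t * (M + 1) := by exact_mod_cast hn2
  have ht0R : (1 : ℝ) ≤ t := by exact_mod_cast ht0
  have htMR : (10 : ℝ) ^ 40 * t ≤ t * M := by nlinarith
  have hCk : ∀ F : Finset (List V), (k / 1000) ^ (k - 1) ≤ 2 ^ k * #F ∧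
      ((∀ l ∈ F, l.length = k ∧ IsCyc G l) ∨ ∀ l ∈ F, l.length = k ∧ IsCyc Gᶜ l) →
      ∃ (F : Finset (List V)) (d : ℕ), k ≤ 10 ^ 20 * T * d ∧ d ^ (k - 1) ≤ 2 ^ k * #F ∧
      ((∀ l ∈ F, l.length = k ∧ IsCyc G l) ∨ ∀ l ∈ F, l.length = k ∧ IsCyc Gᶜ l) := by
    intro F hF
    refine ⟨F, k / 1000, ?_, hF⟩
    have h1 : 10 ^ 20 * 1 ≤ 10 ^ 20 * T := Nat.mul_le_mul_left _ hT1
    have h2 := Nat.mul_le_mul_right (k / 1000) h1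
    lia
  obtain ⟨H, hH⟩ : ∃ H, H = clusterGraph G P (1 / 10 ^ 20) (1 / 10 ^ 9) := ⟨_, rfl⟩
  have hbad := card_adj_not_clusterGraph_le (θ := 1 / 10 ^ 9) hP hPu (by positivity) (by positivity)
    (by
      have : (10 : ℝ) ^ 21 ≤ t := by rw [hl] at hlP; rify at hlP; exact hlP
      rw [ht]
      linarith)
  rw [← hH] at hbad
  set bad : Finset (V × V) := {p | G.Adj p.1 p.2 ∧ ¬ H.Adj (partOf P p.1) (partOf P p.2)} with hbd
  have hsum : ∑ v, H.degree v = #{q : P.parts × P.parts | H.Adj q.1 q.2} :=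
    sum_degree_eq_card_adj
  have hσ : (1 / 2 - 1 / 10 ^ 8) * (t : ℝ) ^ 2 ≤ ∑ v, (H.degree v : ℝ) := by
    have hsub : ({p | G.Adj p.1 p.2} : Finset (V × V)) ⊆ bad ∪
        ({p | (partOf P p.1, partOf P p.2) ∈
          ({q | H.Adj q.1 q.2} : Finset (P.parts × P.parts))} : Finset (V × V)) := by
      intro p
      simp only [mem_filter, mem_univ, true_and, mem_union, hbd]
      tauto
    have h1 := (card_le_card hsub).trans ((card_union_le _ _).trans
      (Nat.add_le_add_left (card_filter_partOf_le hM2 _) _))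
    rw [← hsum] at h1
    rify at h1
    exact cluster_degree_sum_ge hadj (h1.trans (add_le_add_left hbad _)) hn1R hMR hNR
      (by positivity) (by positivity)
  have htc : Fintype.card P.parts = t := by rw [Fintype.card_coe, ht]
  rcases cluster_trichotomy (H := H) (by lia) (by rwa [htc]) with
    ⟨x₀, S, f, q, hS, hf, hfadj, hq, hql, hSc⟩ | ⟨A, hA⟩ | ⟨X, hX1, hX2, hX⟩
  · rw [htc] at hql hSc
    obtain ⟨F, hF, hF'⟩ := exists_many_isCyc_of_cluster_matching hk ht hV hM1 hM2 hM40 ht0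
      (by lia) hH hS hf hfadj hq hql hSc
    refine ⟨F, _, ?_, hF.trans (Nat.le_mul_of_pos_left _ (by positivity)), Or.inl hF'⟩
    have h1 : M + 1 ≤ 10 ^ 20 * (M / 10 ^ 20 + 1) := by lia
    have h2 : t * (M + 1) ≤ T * (10 ^ 20 * (M / 10 ^ 20 + 1)) := Nat.mul_le_mul hPT' h1
    have h3 : T * (10 ^ 20 * (M / 10 ^ 20 + 1)) = 10 ^ 20 * T * (M / 10 ^ 20 + 1) := by ring
    lia
  · rw [htc] at hA
    refine (exists_many_isCyc_of_near_bipartite_of_card_adj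
      (P := univ.filter fun v => partOf P v ∈ A) hk hk10 hV hadj ?_).elim hCk
    have hsub : ({p | G.Adj p.1 p.2 ∧ (p.1 ∈ (univ.filter fun v => partOf P v ∈ A) ↔
        p.2 ∈ (univ.filter fun v => partOf P v ∈ A))} : Finset (V × V)) ⊆ bad ∪
        ({p | (partOf P p.1, partOf P p.2) ∈
          ({q | H.Adj q.1 q.2 ∧ (q.1 ∈ A ↔ q.2 ∈ A)} : Finset (P.parts × P.parts))} :
          Finset (V × V)) := by
      intro p
      simp only [mem_filter, mem_univ, true_and, mem_union, hbd]
      tauto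
    have h1 := (card_le_card hsub).trans ((card_union_le _ _).trans
      (Nat.add_le_add_left (card_filter_partOf_le hM2 _) _))
    rify at h1
    refine h1.trans ?_
    have h2 : (#{q : P.parts × P.parts | H.Adj q.1 q.2 ∧ (q.1 ∈ A ↔ q.2 ∈ A)} : ℝ) *
        (((M : ℝ) + 1) * (M + 1)) ≤ 4 / 10 ^ 16 * (t : ℝ) ^ 2 * ((M + 1) * (M + 1)) := by
      gcongr
    have h3 : ((t : ℝ) * (M + 1)) ^ 2 ≤ (2 * Fintype.card V) ^ 2 := by
      apply pow_le_pow_left₀ (by positivity)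
      linarith
    nlinarith
  · rw [htc] at hX1 hX2
    have hc1 := card_filter_partOf_mem_ge hM1 X
    have hc2 := card_filter_partOf_mem_ge hM1 Xᶜ
    have hcompl : (univ.filter fun v : V => partOf P v ∈ Xᶜ) =
        (univ.filter fun v => partOf P v ∈ X)ᶜ := by
      ext v; simp
    rw [hcompl] at hc2
    have hXc := card_add_card_compl X
    rw [htc] at hXc
    have hPc := card_add_card_compl (univ.filter fun v : V => partOf P v ∈ X)
    refine (exists_many_isCyc_of_near_disconnected (G := G)
      (P := univ.filter fun v => partOf P v ∈ X) hk hk10 hV ?_ ?_ ?_).elim hCk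
    · rify at hc1
      nlinarith
    · rify at hc2 hXc hPc
      have h1 : ((#Xᶜ : ℕ) : ℝ) = t - #X := by linarith
      rw [h1] at hc2
      nlinarith
    · rw [sum_card_filter_eq_card]
      refine le_trans ((Nat.cast_le (α := ℝ)).2 (card_le_card (t := bad) ?_)) ?_
      · intro p
        simp only [mem_filter, mem_product, mem_compl, mem_univ, true_and, hbd]
        exact fun h => ⟨h.2, fun h' => h.1.2 (hX _ h.1.1 _ h')⟩
      · refine hbad.trans ?_
        gcongr
        norm_num

end Majority

section Counting

open Finset

lemma pow_le_cycleCount_of_many_isCyc {V : Type*} [Finite V] {G : SimpleGraph V} {k C B d : ℕ}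
    (hB : 64 ≤ B) (hC : 0 < C) (hk : 2 ≤ k) (hd : k ≤ C * d) {F : Finset (List V)}
    (hdF : d ^ (k - 1) ≤ 2 ^ k * #F) (hF : ∀ l ∈ F, l.length = k ∧ IsCyc G l)
    {x : ℝ} (hx : C * B * x = k) (hx1 : 1 ≤ x) : x ^ k ≤ cycleCount G k := by
  have : NeZero k := ⟨by lia⟩
  have hN := card_le_cyclic_maps F hF
  unfold cycleCount
  generalize Nat.card {p : ZMod k → V // Function.Injective p ∧ ∀ i, G.Adj (p i) (p (i + 1))} = N
    at hN ⊢
  obtain ⟨j, rfl⟩ : ∃ j, k = j + 2 := ⟨k - 2, by lia⟩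
  have hC1 : (1 : ℝ) ≤ C := by exact_mod_cast hC
  have hB' : (64 : ℝ) ≤ B := by exact_mod_cast hB
  have hxd : 64 * x ≤ d := by
    have h1 : C * (B * x) ≤ C * (d : ℝ) := by rw [← mul_assoc, hx]; exact_mod_cast hd
    have h2 := le_of_mul_le_mul_left h1 (by linarith)
    nlinarith
  have hxk : 64 * x ≤ (j + 2 : ℕ) := by
    rw [← hx]
    have : (64 : ℝ) ≤ C * B := by nlinarith
    gcongr
  have h2j : ((j + 2 : ℕ) : ℝ) ≤ 2 ^ (j + 2) := by exact_mod_cast Nat.lt_two_pow_self.le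
  have hmaps : (64 * x) ^ (j + 1) ≤ 2 ^ (j + 2) * (N : ℝ) := by
    calc (64 * x) ^ (j + 1) ≤ (d : ℝ) ^ (j + 1) := by gcongr
      _ ≤ 2 ^ (j + 2) * (#F : ℝ) := by exact_mod_cast hdF
      _ ≤ _ := by gcongr
  have hconst : (2 : ℝ) ^ (j + 2) * (4 * (j + 2 : ℕ) * x) ≤ 64 ^ (j + 1) := by
    calc (2 : ℝ) ^ (j + 2) * (4 * (j + 2 : ℕ) * x)
        = 2 ^ (j + 2) * ((j + 2 : ℕ) * (64 * x)) / 16 := by ring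
      _ ≤ 2 ^ (j + 2) * (2 ^ (j + 2) * 2 ^ (j + 2)) / 16 := by
          gcongr
          exact hxk.trans h2j
      _ = 4 * 8 ^ j := by
          rw [show (8 : ℝ) = 2 * 2 * 2 by norm_num, mul_pow, mul_pow]; ring
      _ ≤ 64 * 64 ^ j := by gcongr <;> norm_num
      _ = 64 ^ (j + 1) := by ring
  have hlarge : 4 * (j + 2 : ℕ) * x ^ (j + 2) ≤ N := by
    have h2 : (0 : ℝ) < 2 ^ (j + 2) := by positivity
    refine le_of_mul_le_mul_left ?_ h2
    calc (2 : ℝ) ^ (j + 2) * (4 * (j + 2 : ℕ) * x ^ (j + 2))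
        = 2 ^ (j + 2) * (4 * (j + 2 : ℕ) * x) * x ^ (j + 1) := by ring
      _ ≤ 64 ^ (j + 1) * x ^ (j + 1) := by gcongr
      _ = (64 * x) ^ (j + 1) := (mul_pow ..).symm
      _ ≤ _ := hmaps
  have hfloor : (N : ℝ) ≤ 2 * (j + 2 : ℕ) * ((N / (2 * (j + 2)) : ℕ) + 1) := by
    exact_mod_cast (Nat.lt_mul_div_succ N (by lia : 0 < 2 * (j + 2))).le
  have h1 : 1 ≤ x ^ (j + 2) := one_le_pow₀ hx1
  have h3 := hlarge.trans hfloor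
  have hj : (0 : ℝ) < (j + 2 : ℕ) := by positivity
  nlinarith

lemma card_filter_adj_add_compl {V : Type*} [Fintype V] [DecidableEq V] (G : SimpleGraph V)
    [DecidableRel G.Adj] :
    #{p : V × V | G.Adj p.1 p.2} + #{p : V × V | Gᶜ.Adj p.1 p.2} =
      Fintype.card V * Fintype.card V - Fintype.card V := by
  rw [← card_univ (α := V), ← offDiag_card, ← card_union_of_disjoint]
  · congr 1
    ext p
    simp only [mem_union, mem_filter, mem_univ, true_and, SimpleGraph.compl_adj, mem_offDiag]
    have := G.ne_of_adj (a := p.1) (b := p.2)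
    tauto
  · rw [disjoint_filter]
    simp +contextual

end Counting

/-- There is a positive constant `c` such that for every odd `k ≥ 5`, every red/blue
two-coloring of the edges of the complete graph on `2 * k - 1` vertices (given by its red
graph `R`; the blue graph is the complement `Rᶜ`) contains at least `(c * k) ^ k`
monochromatic cycles of length `k`. -/
theorem stmt_0 :
    ∃ c : ℝ, 0 < c ∧ ∀ k : ℕ, Odd k → 5 ≤ k →
      ∀ R : SimpleGraph (Fin (2 * k - 1)),
        (c * k) ^ k ≤ ((cycleCount R k + cycleCount Rᶜ k : ℕ) : ℝ) := by
  classical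
  obtain ⟨C, K, hC, hmany⟩ := exists_many_isCyc_of_majority
  have hC1 : (1 : ℝ) ≤ C := by exact_mod_cast hC
  have hB : (0 : ℝ) < (64 + K : ℕ) := by positivity
  refine ⟨1 / (C * (64 + K : ℕ)), by positivity, fun k hk hk5 R => ?_⟩
  set x : ℝ := 1 / (C * (64 + K : ℕ)) * k with hxdef
  have hx : C * (64 + K : ℕ) * x = k := by rw [hxdef]; field_simp
  have hx0 : 0 ≤ x := by positivity
  rcases le_or_gt x 1 with hx1 | hx1
  · refine (pow_le_one₀ hx0 hx1).trans ?_
    have h3 : 3 ≤ k := by lia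
    rcases hasCyc_or_hasCyc_compl hk hk5 (Fintype.card_fin _) R with h | h
    · exact_mod_cast (h.one_le_cycleCount h3).trans (Nat.le_add_right _ _)
    · exact_mod_cast (h.one_le_cycleCount h3).trans (Nat.le_add_left _ _)
  have hKk : K ≤ k := by
    have : ((64 + K : ℕ) : ℝ) ≤ k := by
      rw [← hx, mul_comm (C : ℝ), mul_assoc]
      exact le_mul_of_one_le_right hB.le (by nlinarith)
    have : 64 + K ≤ k := by exact_mod_cast this
    lia
  have majority (G : SimpleGraph (Fin (2 * k - 1))) [DecidableRel G.Adj]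
      (hG : (Fintype.card (Fin (2 * k - 1)) : ℝ) * (Fintype.card (Fin (2 * k - 1)) - 1) / 2 ≤
        Finset.card {p : Fin (2 * k - 1) × Fin (2 * k - 1) | G.Adj p.1 p.2}) :
      x ^ k ≤ (cycleCount G k : ℝ) + cycleCount Gᶜ k := by
    obtain ⟨F, d, hd, hdF, hF | hF⟩ := hmany _ G k hk hKk (Fintype.card_fin _) hG
    · have := pow_le_cycleCount_of_many_isCyc (by lia) hC (by lia) hd hdF hF hx hx1.le
      exact this.trans (le_add_of_nonneg_right (Nat.cast_nonneg _))
    · have := pow_le_cycleCount_of_many_isCyc (by lia) hC (by lia) hd hdF hF hx hx1.le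
      exact this.trans (le_add_of_nonneg_left (Nat.cast_nonneg _))
  have hsum := card_filter_adj_add_compl R
  rify [Nat.le_mul_self] at hsum
  push_cast
  by_cases hR : (Fintype.card (Fin (2 * k - 1)) : ℝ) * (Fintype.card (Fin (2 * k - 1)) - 1) / 2 ≤
      Finset.card {p : Fin (2 * k - 1) × Fin (2 * k - 1) | R.Adj p.1 p.2}
  · exact majority R hR
  · have := majority Rᶜ (by linarith)
    rwa [compl_compl, add_comm] at this
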